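/- arXiv:2209.13405 — 2 statements merged into one kernel-verified Lean document; each statement's English description precedes it below -/
import Mathlib

section
/- Under Assumptions 1 and 2 with L = 1, if moreover η > 0 and t ≤ 1/8, then for all z = (x,v), z' = (x',v') ∈ ℝ^{2d} and all n ≥ 2: Ent(δ_z Qⁿ | δ_{z'} Qⁿ) ≤ ĉ_n(t) · (|x − x'|² + (η n' t)²|v − v'|²), where n' = min(n, ⌊1/(4t)⌋), s = t·n', γ = (1−η)/t, and ĉ_n(t) = ĉ_*(s) = (s/γ)·(12/(ηs²) + 6γ/(ηs) + 4)² + 132 (L_H s)². -/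
open MeasureTheory Real Set

noncomputable section

abbrev Ed (d : ℕ) := EuclideanSpace ℝ (Fin d)
abbrev Phase (d : ℕ) := Ed d × Ed d

/-- Standard Gaussian measure `N(0, I_d)` on `ℝ^d`, defined by normalising the density
`exp (-‖v‖²/2)` with respect to the Lebesgue measure. -/
def stdGaussian (d : ℕ) : Measure (Ed d) :=
  ((volume.withDensity fun v : Ed d => ENNReal.ofReal (Real.exp (-‖v‖ ^ 2 / 2))) Set.univ)⁻¹ •
    volume.withDensity fun v : Ed d => ENNReal.ofReal (Real.exp (-‖v‖ ^ 2 / 2))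

/-- The probability measure with density proportional to `exp (-U)`. -/
def gibbs {d : ℕ} (U : Ed d → ℝ) : Measure (Ed d) :=
  ((volume.withDensity fun x => ENNReal.ofReal (Real.exp (-U x))) Set.univ)⁻¹ •
    volume.withDensity fun x => ENNReal.ofReal (Real.exp (-U x))

/-- The equilibrium measure `μ = π ⊗ N(0, I_d)` on phase space. -/
def eqMeasure {d : ℕ} (U : Ed d → ℝ) : Measure (Phase d) := (gibbs U).prod (stdGaussian d)

/-- Relative entropy `Ent(ν|μ) = ∫ ln (dν/dμ) dν`. -/
def relEnt {α : Type*} [MeasurableSpace α] (ν μ : Measure α) : ℝ :=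
  ∫ z, Real.log ((ν.rnDeriv μ z).toReal) ∂ν

/-- Gradient in the position variable. -/
def gradX {d : ℕ} (h : Phase d → ℝ) (z : Phase d) : Ed d := gradient (fun x => h (x, z.2)) z.1

/-- Gradient in the velocity variable. -/
def gradV {d : ℕ} (h : Phase d → ℝ) (z : Phase d) : Ed d := gradient (fun v => h (z.1, v)) z.2

/-- `h` is a (nonnegative, C¹) density of `ν` with respect to `μ` on phase space. -/
def IsDensityOf {d : ℕ} (h : Phase d → ℝ) (ν μ : Measure (Phase d)) : Prop :=
  (∀ z, 0 ≤ h z) ∧ ContDiff ℝ 1 h ∧ ν = μ.withDensity fun z => ENNReal.ofReal (h z)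

/-- `h` is a (nonnegative, C¹) density of `ν` with respect to `μ` on `ℝ^m`. -/
def IsDensityOfE {m : ℕ} (h : Ed m → ℝ) (ν μ : Measure (Ed m)) : Prop :=
  (∀ x, 0 ≤ h x) ∧ ContDiff ℝ 1 h ∧ ν = μ.withDensity fun x => ENNReal.ofReal (h x)

/-- Logarithmic Sobolev inequality with constant `C` for a measure on `ℝ^d`, in the
functional form `∫ g ln g dπ ≤ C ∫ |∇g|²/g dπ` over C¹ probability densities `g`. -/
def HasLSI {d : ℕ} (pm : Measure (Ed d)) (C : ℝ) : Prop :=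
  ∀ g : Ed d → ℝ, ContDiff ℝ 1 g → (∀ x, 0 ≤ g x) → (∫ x, g x ∂pm) = 1 →
    ∫ x, g x * Real.log (g x) ∂pm ≤ C * ∫ x, ‖gradient g x‖ ^ 2 / g x ∂pm

/-- `G`-Poincaré inequality with constant `C`:  `∫ G(g) dπ ≤ C ∫ G''(g)|∇g|² dπ`. -/
def HasGPoincare {d : ℕ} (pm : Measure (Ed d)) (G : ℝ → ℝ) (C : ℝ) : Prop :=
  ∀ g : Ed d → ℝ, ContDiff ℝ 1 g → (∀ x, 0 ≤ g x) → (∫ x, g x ∂pm) = 1 →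
    ∫ x, G (g x) ∂pm ≤ C * ∫ x, iteratedDeriv 2 G (g x) * ‖gradient g x‖ ^ 2 ∂pm

/-- One transition `ν ↦ νP` of the idealized HMC chain `P = D_η H_t`: the velocity is
refreshed (`v ↦ ηv + √(1-η²) G`) and then the Hamiltonian flow `Φ` is followed for time `t`. -/
def stepP {d : ℕ} (Φ : ℝ → Phase d → Phase d) (t η : ℝ) (ν : Measure (Phase d)) :
    Measure (Phase d) :=
  ν.bind fun z => (stdGaussian d).map fun g => Φ t (z.1, η • z.2 + Real.sqrt (1 - η ^ 2) • g)

/-- One transition `ν ↦ νQ` of the chain `Q = D_η H_t D_η`. -/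
def stepQ {d : ℕ} (Φ : ℝ → Phase d → Phase d) (t η : ℝ) (ν : Measure (Phase d)) :
    Measure (Phase d) :=
  ν.bind fun z => ((stdGaussian d).prod (stdGaussian d)).map fun gg =>
    ((Φ t (z.1, η • z.2 + Real.sqrt (1 - η ^ 2) • gg.1)).1,
      η • (Φ t (z.1, η • z.2 + Real.sqrt (1 - η ^ 2) • gg.1)).2 +
        Real.sqrt (1 - η ^ 2) • gg.2)

/-- One transition `ν ↦ νP_θ` of the HMC chain with random integration time `t ∼ θ`. -/
def stepPtheta {d : ℕ} (Φ : ℝ → Phase d → Phase d) (η : ℝ) (θ : Measure ℝ)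
    (ν : Measure (Phase d)) : Measure (Phase d) :=
  ν.bind fun z => θ.bind fun t =>
    (stdGaussian d).map fun g => Φ t (z.1, η • z.2 + Real.sqrt (1 - η ^ 2) • g)

/-- The modified entropy `L(ν) = Ent(ν|μ) + a ∫ |∇_x h + ∇_v h|²/h dμ`, expressed through a
density `h` of `ν` with respect to `μ`. -/
def modEnt {d : ℕ} (μ : Measure (Phase d)) (a : ℝ) (h : Phase d → ℝ) : ℝ :=
  (∫ z, h z * Real.log (h z) ∂μ) + a * ∫ z, ‖gradX h z + gradV h z‖ ^ 2 / h z ∂μ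

/-- The modified `G`-entropy `L_G(ν) = ∫ G(h) dμ + a ∫ G''(h)|∇_x h + ∇_v h|² dμ`. -/
def modEntG {d : ℕ} (μ : Measure (Phase d)) (G : ℝ → ℝ) (a : ℝ) (h : Phase d → ℝ) : ℝ :=
  (∫ z, G (h z) ∂μ) + a * ∫ z, iteratedDeriv 2 G (h z) * ‖gradX h z + gradV h z‖ ^ 2 ∂μ

/-- The `G`-Fisher information `I_G(ν|μ) = ∫ G''(h)|∇h|² dμ` on phase space. -/
def fisherG {d : ℕ} (μ : Measure (Phase d)) (G : ℝ → ℝ) (h : Phase d → ℝ) : ℝ :=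
  ∫ z, iteratedDeriv 2 G (h z) * (‖gradX h z‖ ^ 2 + ‖gradV h z‖ ^ 2) ∂μ

/-- Squared Euclidean norm `|z|² = |x|² + |v|²` on phase space. -/
def normSq {d : ℕ} (z : Phase d) : ℝ := ‖z.1‖ ^ 2 + ‖z.2‖ ^ 2

/-- Squared `L²` Wasserstein distance on phase space (Euclidean cost), as an infimum over
couplings. -/
def W2sq {d : ℕ} (ν μ' : Measure (Phase d)) : ℝ :=
  ⨅ r : {r : Measure (Phase d × Phase d) // r.map Prod.fst = ν ∧ r.map Prod.snd = μ'},
    ∫ p, normSq (p.1 - p.2) ∂(r : Measure (Phase d × Phase d))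

/-- Frobenius norm of a linear map on `ℝ^d`. -/
def frobNorm {d : ℕ} (A : Ed d →L[ℝ] Ed d) : ℝ :=
  Real.sqrt (∑ i, ∑ j, (A (EuclideanSpace.single j 1) i) ^ 2)

/-- Frobenius norm of a linear map on phase space. -/
def frobNormP {d : ℕ} (A : Phase d →L[ℝ] Phase d) : ℝ :=
  Real.sqrt ((∑ j, normSq (A (EuclideanSpace.single j 1, 0))) +
    ∑ j, normSq (A (0, EuclideanSpace.single j 1)))

/-- Block `2×2` continuous linear map on phase space. -/
def blockCLM {d : ℕ} (M11 M12 M21 M22 : Ed d →L[ℝ] Ed d) : Phase d →L[ℝ] Phase d :=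
  ((M11.comp (ContinuousLinearMap.fst ℝ (Ed d) (Ed d))) +
      (M12.comp (ContinuousLinearMap.snd ℝ (Ed d) (Ed d)))).prod
    ((M21.comp (ContinuousLinearMap.fst ℝ (Ed d) (Ed d))) +
      (M22.comp (ContinuousLinearMap.snd ℝ (Ed d) (Ed d))))

/-- One step of the HMC chain driven by the explicit noise `ω = (t, g)`. -/
def chainStep {d : ℕ} (Φ : ℝ → Phase d → Phase d) (η : ℝ) (ω : ℝ × Ed d) (z : Phase d) :
    Phase d :=
  Φ ω.1 (z.1, η • z.2 + Real.sqrt (1 - η ^ 2) • ω.2)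

/-- `n` steps of the HMC chain driven by the explicit noise sequence `ω`. -/
def chainIter {d : ℕ} (Φ : ℝ → Phase d → Phase d) (η : ℝ) :
    (n : ℕ) → (Fin n → ℝ × Ed d) → Phase d → Phase d
  | 0, _, z => z
  | n + 1, ω, z => chainIter Φ η n (fun i => ω i.succ) (chainStep Φ η (ω 0) z)

/-- The convergence rate `ρ` of Theorem 2.1 as a function of the parameters. -/
def rhoHMC (η a t : ℝ) : ℝ :=
  let m₁ := 2 * t - 21 / 10 * t ^ 2
  let m₂ := 1 + η * (-1 + 2 * t + 13 / 5 * t ^ 2)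
  let m₃ := 1 - η ^ 2 * (1 + 2 * t + 31 / 10 * t ^ 2) + (1 - η ^ 2) / (2 * a)
  if η = 0 then (1 - 3 * t) * (m₁ - 2 * a / (2 * a + 1))
  else (1 - 3 * t) * ((m₁ + m₃ * (η⁻¹) ^ 2) / 2 -
    Real.sqrt (m₂ ^ 2 * (η⁻¹) ^ 2 + ((m₁ - m₃ * (η⁻¹) ^ 2) / 2) ^ 2))

/-- The critical depth `c*` of the potential `U`: infimum, over continuous paths `Γ` going
from a local minimum of `U` to a global minimum of `U`, of the maximal elevation gain. -/
def critDepth {d : ℕ} (U : Ed d → ℝ) : ℝ :=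
  sInf {c : ℝ | ∃ Γ : ℝ → Ed d, ContinuousOn Γ (Set.Icc 0 1) ∧ IsLocalMin U (Γ 0) ∧
    (∀ y, U (Γ 1) ≤ U y) ∧ c = sSup ((fun s => U (Γ s)) '' Set.Icc 0 1) - U (Γ 0)}

/-- The function `D_η h` obtained from `h` by the velocity-refreshment operator. -/
def refreshFun {d : ℕ} (η : ℝ) (h : Phase d → ℝ) (z : Phase d) : ℝ :=
  ∫ g, h (z.1, η • z.2 + Real.sqrt (1 - η ^ 2) • g) ∂stdGaussian d

end

/-- The dual (Donsker–Varadhan) form of the inequality `Ent(ν|μ) ≤ C`. -/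
def EntropyDualLE {α : Type*} [MeasurableSpace α] (ν μ : Measure α) (C : ℝ) : Prop :=
  ∀ f : α → ℝ, Measurable f → (∃ M, ∀ x, |f x| ≤ M) →
    ∫ x, f x ∂ν ≤ Real.log (∫ x, Real.exp (f x) ∂μ) + C

section EntropyDual

variable {α : Type*} [MeasurableSpace α]

lemma integrable_of_abs_le {μ : Measure α} [IsFiniteMeasure μ] {f : α → ℝ} (hf : Measurable f)
    {M : ℝ} (hM : ∀ x, |f x| ≤ M) : Integrable f μ :=
  Integrable.of_bound hf.aestronglyMeasurable M (Filter.Eventually.of_forall hM)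

lemma integrable_exp_of_abs_le {μ : Measure α} [IsFiniteMeasure μ] {f : α → ℝ}
    (hf : Measurable f) {M : ℝ} (hM : ∀ x, |f x| ≤ M) : Integrable (fun x => exp (f x)) μ :=
  integrable_of_abs_le (M := exp M) hf.exp fun x => by
    rw [abs_of_pos (exp_pos _)]; exact exp_le_exp.2 ((le_abs_self _).trans (hM x))

lemma integral_le_log_integral_exp {μ : Measure α} [IsProbabilityMeasure μ] {f : α → ℝ}
    (hf : Integrable f μ) (hf' : Integrable (fun x => exp (f x)) μ) :
    ∫ x, f x ∂μ ≤ log (∫ x, exp (f x) ∂μ) := by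
  have h := convexOn_exp.map_integral_le (μ := μ) (f := f) continuous_exp.continuousOn
    isClosed_univ (by simp) hf hf'
  rw [← log_exp (∫ x, f x ∂μ)]
  exact log_le_log (exp_pos _) h

lemma EntropyDualLE.refl (μ : Measure α) [IsProbabilityMeasure μ] : EntropyDualLE μ μ 0 := by
  rintro f hf ⟨M, hM⟩
  rw [add_zero]
  exact integral_le_log_integral_exp (integrable_of_abs_le hf hM) (integrable_exp_of_abs_le hf hM)

lemma EntropyDualLE.mono {ν μ : Measure α} {C C' : ℝ} (h : EntropyDualLE ν μ C) (hC : C ≤ C') :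
    EntropyDualLE ν μ C' := fun f hf hM => (h f hf hM).trans (by linarith)

lemma EntropyDualLE.absolutelyContinuous {ν μ : Measure α} [IsProbabilityMeasure ν]
    [IsProbabilityMeasure μ] {C : ℝ} (h : EntropyDualLE ν μ C) : ν ≪ μ := by
  refine Measure.AbsolutelyContinuous.mk fun A hA hμA => ?_
  by_contra hνA
  have hpos : 0 < ν.real A := by
    rw [Measure.real]; exact ENNReal.toReal_pos hνA (measure_ne_top _ _)
  have key := h (A.indicator fun _ => (C + 1) / ν.real A) (measurable_const.indicator hA)
    ⟨|(C + 1) / ν.real A|, fun x => by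
      by_cases hx : x ∈ A <;> simp [hx]⟩
  rw [integral_indicator_const _ hA] at key
  have h1 : ∫ x, exp (A.indicator (fun _ => (C + 1) / ν.real A) x) ∂μ = 1 := by
    have : ∀ᵐ x ∂μ, exp (A.indicator (fun _ => (C + 1) / ν.real A) x) = 1 := by
      filter_upwards [measure_eq_zero_iff_ae_notMem.1 hμA] with x hx
      simp [hx]
    rw [integral_congr_ae this]; simp
  rw [h1, log_one, smul_eq_mul, mul_div_cancel₀ _ hpos.ne'] at key
  linarith

lemma log_clamp_eq {r k : ℝ} (hr : 0 < r) :
    log (max (exp (-k)) (min r (exp k))) = max (-k) (min (log r) k) := by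
  obtain ⟨y, rfl⟩ : ∃ y, r = exp y := ⟨log r, (exp_log hr).symm⟩
  rw [← exp_monotone.map_min, ← exp_monotone.map_max, log_exp, log_exp]

lemma relEnt_le_of_entropyDualLE {ν μ : Measure α} [IsProbabilityMeasure ν]
    [IsProbabilityMeasure μ] {C : ℝ} (hC : 0 ≤ C) (h : EntropyDualLE ν μ C) :
    relEnt ν μ ≤ C := by
  have hac := h.absolutelyContinuous
  unfold relEnt
  set r : α → ℝ := fun z => (ν.rnDeriv μ z).toReal with hr
  have hrm : Measurable r := (Measure.measurable_rnDeriv ν μ).ennreal_toReal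
  by_cases hint : Integrable (fun z => log (r z)) ν
  swap
  · rw [integral_undef hint]; exact hC
  have hpos : ∀ᵐ z ∂ν, 0 < r z := by
    filter_upwards [Measure.rnDeriv_pos hac, hac.ae_le (Measure.rnDeriv_lt_top ν μ)] with z h1 h2
    exact ENNReal.toReal_pos h1.ne' h2.ne
  let f : ℕ → α → ℝ := fun k z => log (max (exp (-(k : ℝ))) (min (r z) (exp k)))
  have hcl : ∀ (k : ℕ) z, 0 < max (exp (-(k : ℝ))) (min (r z) (exp k)) := fun k z =>
    lt_max_of_lt_left (exp_pos _)
  have hfm : ∀ k, Measurable (f k) := fun k =>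
    (measurable_const.max (hrm.min measurable_const)).log
  have hfb : ∀ (k : ℕ) z, |f k z| ≤ k := by
    intro k z
    rw [abs_le]
    constructor
    · rw [Real.le_log_iff_exp_le (hcl k z)]; exact le_max_left _ _
    · rw [Real.log_le_iff_le_exp (hcl k z)]
      exact max_le (exp_le_exp.2 (by linarith [(Nat.cast_nonneg k : (0:ℝ) ≤ k)])) (min_le_right _ _)
  have hrint : Integrable r μ := Measure.integrable_toReal_rnDeriv
  have hlim : Filter.Tendsto (fun k => ∫ z, f k z ∂ν) Filter.atTop (nhds (∫ z, log (r z) ∂ν)) := by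
    refine tendsto_integral_of_dominated_convergence (fun z => |log (r z)|)
      (fun k => (hfm k).aestronglyMeasurable) hint.abs ?_ ?_
    · intro k
      filter_upwards [hpos] with z hz
      simp only [f, log_clamp_eq hz, Real.norm_eq_abs]
      have hk : (0:ℝ) ≤ k := Nat.cast_nonneg k
      rw [abs_le]
      constructor
      · refine le_max_of_le_right (le_min (neg_abs_le _) (le_trans ?_ hk))
        simp
      · exact max_le (by linarith [abs_nonneg (log (r z))])
          ((min_le_left _ _).trans (le_abs_self _))
    · filter_upwards [hpos] with z hz
      refine tendsto_const_nhds.congr' ?_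
      filter_upwards [Filter.eventually_ge_atTop ⌈|log (r z)|⌉₊] with k hk
      have hk' : |log (r z)| ≤ k := Nat.ceil_le.1 hk
      simp only [f, log_clamp_eq hz]
      rw [abs_le] at hk'
      rw [min_eq_left hk'.2, max_eq_right hk'.1]
  have hbound : ∀ k : ℕ, ∫ z, f k z ∂ν ≤ exp (-(k : ℝ)) + C := by
    intro k
    refine (h (f k) (hfm k) ⟨k, hfb k⟩).trans ?_
    have h1 : ∫ z, exp (f k z) ∂μ ≤ 1 + exp (-(k : ℝ)) := by
      calc ∫ z, exp (f k z) ∂μ ≤ ∫ z, (r z + exp (-(k : ℝ))) ∂μ := by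
            refine integral_mono (integrable_exp_of_abs_le (hfm k) (hfb k))
              (hrint.add (integrable_const _)) fun z => ?_
            simp only [f]
            rw [exp_log (hcl k z)]
            have hrz : 0 ≤ r z := ENNReal.toReal_nonneg
            exact max_le (by linarith) ((min_le_left _ _).trans (by linarith [exp_pos (-(k:ℝ))]))
        _ = 1 + exp (-(k : ℝ)) := by
            rw [integral_add hrint (integrable_const _), Measure.integral_toReal_rnDeriv hac]
            simp
    have h0 : 0 < ∫ z, exp (f k z) ∂μ :=
      integral_exp_pos (integrable_exp_of_abs_le (hfm k) (hfb k))
    have := Real.log_le_sub_one_of_pos h0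
    linarith
  refine le_of_tendsto_of_tendsto' hlim (b := Filter.atTop)
    (f := fun k : ℕ => ∫ z, f k z ∂ν) (g := fun k : ℕ => exp (-(k : ℝ)) + C) ?_ hbound
  have : Filter.Tendsto (fun k : ℕ => exp (-(k : ℝ))) Filter.atTop (nhds 0) :=
    Real.tendsto_exp_neg_atTop_nhds_zero.comp tendsto_natCast_atTop_atTop
  simpa using this.add_const C

open ProbabilityTheory in
lemma integral_bind_kernel {β : Type*} [MeasurableSpace β] (N : Measure β) [IsProbabilityMeasure N]
    (κ : Kernel β α) [IsMarkovKernel κ] {f : α → ℝ} (hf : Measurable f) {M : ℝ}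
    (hM : ∀ x, |f x| ≤ M) : ∫ x, f x ∂(N.bind κ) = ∫ g, ∫ x, f x ∂(κ g) ∂N := by
  have h := Kernel.integral_comp (κ := Kernel.const Unit N) (η := κ) (a := ()) (f := f)
    (integrable_of_abs_le hf hM)
  simpa [Kernel.comp_apply] using h

lemma abs_integral_le_of_abs_le {μ : Measure α} [IsProbabilityMeasure μ] {f : α → ℝ} {M : ℝ}
    (hM : ∀ x, |f x| ≤ M) : |∫ x, f x ∂μ| ≤ M := by
  simpa using norm_integral_le_of_norm_le_const (μ := μ) (f := f) (Filter.Eventually.of_forall hM)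

lemma abs_log_integral_exp_le {μ : Measure α} [IsProbabilityMeasure μ] {f : α → ℝ}
    (hf : Measurable f) {M : ℝ} (hM : ∀ x, |f x| ≤ M) :
    |log (∫ x, exp (f x) ∂μ)| ≤ M := by
  have hi := integrable_exp_of_abs_le (μ := μ) hf hM
  have hpos := integral_exp_pos hi
  rw [abs_le]
  constructor
  · rw [Real.le_log_iff_exp_le hpos]
    have := integral_mono (μ := μ) (integrable_const (exp (-M))) hi
      fun x => exp_le_exp.2 (abs_le.1 (hM x)).1
    simpa using this
  · rw [Real.log_le_iff_le_exp hpos]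
    have := integral_mono (μ := μ) hi (integrable_const (exp M))
      fun x => exp_le_exp.2 (abs_le.1 (hM x)).2
    simpa using this

open ProbabilityTheory in
/-- If moving the mixing parameter by `T` costs `c`, and the kernels at `g` and `T g` are at
entropic distance at most `C`, then the mixtures are at entropic distance at most `c + C`. -/
lemma EntropyDualLE.bind {β : Type*} [MeasurableSpace β] {N : Measure β} [IsProbabilityMeasure N]
    {κ₁ κ₂ : Kernel β α} [IsMarkovKernel κ₁] [IsMarkovKernel κ₂] {T : β → β} (hT : Measurable T)
    {c C : ℝ} (hcT : EntropyDualLE (N.map T) N c)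
    (h : ∀ g, EntropyDualLE (κ₁ g) (κ₂ (T g)) C) :
    EntropyDualLE (N.bind κ₁) (N.bind κ₂) (c + C) := by
  rintro f hf ⟨M, hM⟩
  have hem : Measurable fun x => exp (f x) := hf.exp
  have heM : ∀ x, |exp (f x)| ≤ exp M := fun x => by
    rw [abs_of_pos (exp_pos _)]; exact exp_le_exp.2 ((le_abs_self _).trans (hM x))
  rw [integral_bind_kernel N κ₁ hf hM, integral_bind_kernel N κ₂ hem heM]
  let φ : β → ℝ := fun g => log (∫ x, exp (f x) ∂κ₂ g)
  have hφm : Measurable φ := (hem.stronglyMeasurable.integral_kernel (κ := κ₂)).measurable.log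
  have hφM : ∀ g, |φ g| ≤ M := fun g => abs_log_integral_exp_le hf hM
  have h1 := hcT φ hφm ⟨M, hφM⟩
  rw [integral_map hT.aemeasurable hφm.aestronglyMeasurable] at h1
  have h2 : ∀ g, exp (φ g) = ∫ x, exp (f x) ∂κ₂ g := fun g =>
    exp_log (integral_exp_pos (integrable_exp_of_abs_le hf hM))
  simp only [h2] at h1
  have hφT : Integrable (fun g => φ (T g)) N :=
    integrable_of_abs_le (hφm.comp hT) fun g => hφM _
  have h3 : ∫ g, ∫ x, f x ∂κ₁ g ∂N ≤ ∫ g, (φ (T g) + C) ∂N := by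
    refine integral_mono ?_ ?_ fun g => h g f hf ⟨M, hM⟩
    · exact integrable_of_abs_le (hf.stronglyMeasurable.integral_kernel (κ := κ₁)).measurable
        fun g => abs_integral_le_of_abs_le hM
    · exact hφT.add (integrable_const _)
  rw [integral_add hφT (integrable_const _)] at h3
  simp only [integral_const, probReal_univ, smul_eq_mul, one_mul] at h3
  linarith

end EntropyDual

section Frobenius

variable {d : ℕ}

lemma frobNorm_nonneg (A : Ed d →L[ℝ] Ed d) : 0 ≤ frobNorm A := Real.sqrt_nonneg _

lemma frobNorm_sq_eq_sum_norm_sq (A : Ed d →L[ℝ] Ed d) :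
    frobNorm A ^ 2 = ∑ j, ‖A (EuclideanSpace.single j 1)‖ ^ 2 := by
  rw [frobNorm, Real.sq_sqrt (by positivity), Finset.sum_comm]
  exact Finset.sum_congr rfl fun j _ => by simp [EuclideanSpace.norm_sq_eq]

lemma sum_norm_sq_eq_trace {n : ℕ} (A : Ed d →L[ℝ] Ed d) (b : OrthonormalBasis (Fin n) ℝ (Ed d)) :
    ∑ j, ‖A (b j)‖ ^ 2 =
      LinearMap.trace ℝ _ (LinearMap.adjoint A.toLinearMap ∘ₗ A.toLinearMap) := by
  rw [LinearMap.trace_eq_sum_inner _ b]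
  refine Finset.sum_congr rfl fun j _ => ?_
  rw [LinearMap.comp_apply, LinearMap.adjoint_inner_right, real_inner_self_eq_norm_sq]
  rfl

lemma frobNorm_sq_eq_sum_orthonormalBasis {n : ℕ} (A : Ed d →L[ℝ] Ed d)
    (b : OrthonormalBasis (Fin n) ℝ (Ed d)) : frobNorm A ^ 2 = ∑ j, ‖A (b j)‖ ^ 2 := by
  rw [sum_norm_sq_eq_trace A b, ← sum_norm_sq_eq_trace A (EuclideanSpace.basisFun (Fin d) ℝ),
    frobNorm_sq_eq_sum_norm_sq]
  simp

lemma trace_eq_sum_single (A : Ed d →L[ℝ] Ed d) :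
    LinearMap.trace ℝ _ A.toLinearMap = ∑ i, A (EuclideanSpace.single i 1) i := by
  rw [LinearMap.trace_eq_sum_inner _ (EuclideanSpace.basisFun (Fin d) ℝ)]
  refine Finset.sum_congr rfl fun j _ => ?_
  simp [EuclideanSpace.inner_single_left]

lemma norm_sq_add_sub_one_bounds {v w : Ed d} (hv : ‖v‖ = 1) (hw : ‖w‖ ≤ 1 / 4) :
    9 / 16 ≤ ‖v + w‖ ^ 2 ∧
      2 * inner ℝ v w - 8 * ‖w‖ ^ 2 ≤ Real.log (‖v + w‖ ^ 2) := by
  have h0 := norm_nonneg w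
  have hi := abs_real_inner_le_norm v w
  rw [hv, one_mul, abs_le] at hi
  have hexp : ‖v + w‖ ^ 2 = 1 + 2 * inner ℝ v w + ‖w‖ ^ 2 := by
    rw [norm_add_sq_real, hv]; ring
  have hlow : 9 / 16 ≤ ‖v + w‖ ^ 2 := by rw [hexp]; nlinarith
  refine ⟨hlow, ?_⟩
  set y := ‖v + w‖ ^ 2 with hy
  have hypos : 0 < y := by linarith
  have hlog : 1 - y⁻¹ ≤ Real.log y := Real.one_sub_inv_le_log_of_pos hypos
  have h2 : (y - 1) - 16 / 9 * (y - 1) ^ 2 ≤ 1 - y⁻¹ := by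
    have : 1 - y⁻¹ - ((y - 1) - 16 / 9 * (y - 1) ^ 2) = (y - 1) ^ 2 * (16 / 9 * y - 1) / y := by
      field_simp; ring
    have h3 : 0 ≤ (y - 1) ^ 2 * (16 / 9 * y - 1) / y :=
      div_nonneg (mul_nonneg (sq_nonneg _) (by linarith)) hypos.le
    linarith
  have h4 : (y - 1) ^ 2 ≤ (9 / 4 * ‖w‖) ^ 2 := by
    have : |y - 1| ≤ 9 / 4 * ‖w‖ := by
      rw [hexp, abs_le]; constructor <;> nlinarith
    rw [← sq_abs]; gcongr
  nlinarith

lemma abs_det_pos_and_log_ge {A : Ed d →L[ℝ] Ed d} (hA : ‖A‖ ≤ 1 / 4) :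
    0 < |(1 + A).det| ∧
      ∑ i, A (EuclideanSpace.single i 1) i - 4 * frobNorm A ^ 2 ≤ Real.log |(1 + A).det| := by
  set B : Ed d →ₗ[ℝ] Ed d := (1 + A).toLinearMap with hB
  have hS := B.isSymmetric_adjoint_comp_self
  have hn : Module.finrank ℝ (Ed d) = d := by simp
  have hdet : |(1 + A).det| ^ 2 = ∏ i, hS.eigenvalues hn i := by
    have h1 := B.normDet_sq
    rw [hS.det_eq_prod_eigenvalues hn, B.normDet_eq_norm_det] at h1
    simpa using h1
  set b := hS.eigenvectorBasis hn with hb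
  have hb1 : ∀ i, ‖b i‖ = 1 := fun i => b.orthonormal.1 i
  have hμ : ∀ i, hS.eigenvalues hn i = ‖b i + A (b i)‖ ^ 2 := by
    intro i
    have h1 := hS.apply_eigenvectorBasis hn i
    have h2 : inner ℝ (b i) ((LinearMap.adjoint B ∘ₗ B) (b i)) = ‖B (b i)‖ ^ 2 := by
      rw [LinearMap.comp_apply, LinearMap.adjoint_inner_right, real_inner_self_eq_norm_sq]
    rw [hb, h1, ← hb, inner_smul_right, real_inner_self_eq_norm_sq, hb1] at h2
    simpa [hB] using h2
  have hw : ∀ i, ‖A (b i)‖ ≤ 1 / 4 := fun i => by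
    have := A.le_opNorm (b i)
    rw [hb1, mul_one] at this; linarith
  have hk := fun i => norm_sq_add_sub_one_bounds (hb1 i) (hw i)
  have hprod : 0 < ∏ i, hS.eigenvalues hn i :=
    Finset.prod_pos fun i _ => by rw [hμ]; linarith [(hk i).1]
  have hpos : 0 < |(1 + A).det| := by
    rw [← hdet] at hprod
    rcases (abs_nonneg (1 + A).det).lt_or_eq with h | h
    · exact h
    · rw [← h] at hprod; simp at hprod
  refine ⟨hpos, ?_⟩
  have hlog : 2 * Real.log |(1 + A).det| = ∑ i, Real.log (hS.eigenvalues hn i) := by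
    rw [← Real.log_prod fun i _ => by rw [hμ]; linarith [(hk i).1], ← hdet, Real.log_pow]
    simp
  have hsum : ∑ i, (2 * inner ℝ (b i) (A (b i)) - 8 * ‖A (b i)‖ ^ 2) ≤
      ∑ i, Real.log (hS.eigenvalues hn i) :=
    Finset.sum_le_sum fun i _ => by rw [hμ]; linarith [(hk i).2]
  rw [Finset.sum_sub_distrib, ← Finset.mul_sum, ← Finset.mul_sum,
    ← frobNorm_sq_eq_sum_orthonormalBasis, ← hlog] at hsum
  have htr := LinearMap.trace_eq_sum_inner A.toLinearMap b
  rw [trace_eq_sum_single] at htr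
  simp only [ContinuousLinearMap.coe_coe] at htr
  rw [htr]
  nlinarith [sq_nonneg (frobNorm A)]

end Frobenius

section Gaussian

variable {d : ℕ}

/-- The unnormalised standard Gaussian density. -/
noncomputable def gaussWeight (v : Ed d) : ℝ := Real.exp (-‖v‖ ^ 2 / 2)

lemma gaussWeight_pos (v : Ed d) : 0 < gaussWeight v := exp_pos _

lemma continuous_gaussWeight : Continuous (gaussWeight : Ed d → ℝ) := by
  unfold gaussWeight; fun_prop

lemma integral_gaussWeight_pos : 0 < ∫ v : Ed d, gaussWeight v := by
  have h : ∫ v : Ed d, gaussWeight v = _ :=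
    (integral_congr_ae (Filter.Eventually.of_forall fun v => by
      simp only [gaussWeight]; ring_nf)).trans
      (GaussianFourier.integral_rexp_neg_mul_sq_norm (V := Ed d) (b := 1 / 2) (by norm_num))
  rw [h]
  positivity

lemma integrable_gaussWeight : Integrable (gaussWeight : Ed d → ℝ) := by
  by_contra h
  exact integral_gaussWeight_pos.ne' (integral_undef (f := (gaussWeight : Ed d → ℝ)) h)

lemma integrable_norm_mul_gaussWeight : Integrable fun v : Ed d => ‖v‖ * gaussWeight v := by
  have h1 : Integrable fun v : Ed d => rexp (-(1 / 4) * ‖v‖ ^ 2) := by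
    by_contra h
    have h2 := GaussianFourier.integral_rexp_neg_mul_sq_norm (V := Ed d) (b := 1 / 4) (by norm_num)
    rw [integral_undef h] at h2
    have : 0 < (π / (1 / 4)) ^ (Module.finrank ℝ (Ed d) / 2 : ℝ) := by positivity
    exact this.ne h2
  refine h1.mono' ((continuous_norm.mul continuous_gaussWeight).aestronglyMeasurable)
    (Filter.Eventually.of_forall fun v => ?_)
  have h0 := norm_nonneg v
  rw [Real.norm_of_nonneg (mul_nonneg h0 (gaussWeight_pos v).le)]
  have h3 : ‖v‖ ≤ rexp (‖v‖ ^ 2 / 4) := by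
    have := add_one_le_exp (‖v‖ ^ 2 / 4)
    nlinarith [sq_nonneg (‖v‖ / 2 - 1)]
  calc ‖v‖ * gaussWeight v ≤ rexp (‖v‖ ^ 2 / 4) * gaussWeight v := by
        gcongr; exact (gaussWeight_pos v).le
    _ = rexp (-(1 / 4) * ‖v‖ ^ 2) := by
        rw [gaussWeight, ← exp_add]; ring_nf

lemma lintegral_gaussWeight :
    (volume.withDensity fun v : Ed d => ENNReal.ofReal (Real.exp (-‖v‖ ^ 2 / 2))) Set.univ =
      ENNReal.ofReal (∫ v : Ed d, gaussWeight v) := by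
  rw [withDensity_apply _ MeasurableSet.univ, Measure.restrict_univ,
    ofReal_integral_eq_lintegral_ofReal integrable_gaussWeight
      (Filter.Eventually.of_forall fun v => (gaussWeight_pos v).le)]
  rfl

instance : IsProbabilityMeasure (stdGaussian d) := by
  constructor
  rw [stdGaussian, Measure.smul_apply, lintegral_gaussWeight, smul_eq_mul]
  exact ENNReal.inv_mul_cancel (by simpa using integral_gaussWeight_pos) ENNReal.ofReal_ne_top

lemma stdGaussian_eq : stdGaussian d = ENNReal.ofReal (∫ v : Ed d, gaussWeight v)⁻¹ •
    volume.withDensity fun v : Ed d => ENNReal.ofReal (gaussWeight v) := by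
  rw [stdGaussian, lintegral_gaussWeight, ENNReal.ofReal_inv_of_pos integral_gaussWeight_pos]
  rfl

lemma integral_stdGaussian (f : Ed d → ℝ) :
    ∫ g, f g ∂stdGaussian d = (∫ v : Ed d, gaussWeight v)⁻¹ * ∫ g, gaussWeight g * f g := by
  rw [stdGaussian_eq, integral_smul_measure, integral_withDensity_eq_integral_toReal_smul
    continuous_gaussWeight.measurable.ennreal_ofReal (by simp),
    ENNReal.toReal_ofReal (inv_nonneg.2 integral_gaussWeight_pos.le)]
  simp [ENNReal.toReal_ofReal (gaussWeight_pos _).le]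

lemma integrable_stdGaussian_iff {f : Ed d → ℝ} :
    Integrable f (stdGaussian d) ↔ Integrable fun g => gaussWeight g * f g := by
  rw [stdGaussian_eq, integrable_smul_measure
    (by simpa using integral_gaussWeight_pos) ENNReal.ofReal_ne_top,
    integrable_withDensity_iff_integrable_smul' continuous_gaussWeight.measurable.ennreal_ofReal
      (by simp)]
  simp [ENNReal.toReal_ofReal (gaussWeight_pos _).le]

lemma hasFDerivAt_gaussWeight (v : Ed d) :
    HasFDerivAt gaussWeight (-(gaussWeight v) • innerSL ℝ v) v := by
  have h1 : HasFDerivAt (fun v : Ed d => -‖v‖ ^ 2 / 2) (-(innerSL ℝ v)) v := by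
    have := ((hasStrictFDerivAt_norm_sq v).hasFDerivAt.neg).const_mul (1 / 2 : ℝ)
    convert! this using 1
    · ext; simp; ring
    · ext; simp
  convert! h1.exp using 1
  ext; simp [gaussWeight]

/-- Gaussian integration by parts for a bounded vector field with bounded derivative. -/
lemma integral_inner_stdGaussian {h : Ed d → Ed d} {A : Ed d → Ed d →L[ℝ] Ed d}
    (hA : ∀ g, HasFDerivAt h (A g) g) {R K : ℝ} (hR : ∀ g, ‖h g‖ ≤ R) (hK : ∀ g, ‖A g‖ ≤ K) :
    ∫ g, inner ℝ g (h g) ∂stdGaussian d =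
      ∫ g, ∑ i, A g (EuclideanSpace.single i 1) i ∂stdGaussian d := by
  rw [integral_stdGaussian, integral_stdGaussian]
  congr 1
  have hc : Continuous h := continuous_iff_continuousAt.2 fun g => (hA g).continuousAt
  have hAf : ∀ g, A g = fderiv ℝ h g := fun g => (hA g).fderiv.symm
  have hcoord : ∀ i g, HasFDerivAt (fun g => h g i)
      ((EuclideanSpace.proj i : Ed d →L[ℝ] ℝ).comp (A g)) g := fun i g =>
    (EuclideanSpace.proj i : Ed d →L[ℝ] ℝ).hasFDerivAt.comp g (hA g)
  have hcb : ∀ i (v : Ed d), |v i| ≤ ‖v‖ := fun i v => by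
    simpa using PiLp.norm_apply_le v i
  have e1 : ∀ i g, fderiv ℝ (fun g => h g i) g (EuclideanSpace.single i 1) =
      A g (EuclideanSpace.single i 1) i := fun i g => by
    rw [(hcoord i g).fderiv]; rfl
  have e2 : ∀ i (g : Ed d), fderiv ℝ gaussWeight g (EuclideanSpace.single i 1) =
      -(gaussWeight g * g i) := fun i g => by
    rw [(hasFDerivAt_gaussWeight g).fderiv]
    simp [EuclideanSpace.inner_single_right]
  have hm : ∀ i, Measurable fun g => A g (EuclideanSpace.single i 1) i := fun i => by
    simp_rw [hAf]
    exact (EuclideanSpace.proj i : Ed d →L[ℝ] ℝ).measurable.comp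
      (measurable_fderiv_apply_const ℝ h _)
  have i1 : ∀ i, Integrable fun g => A g (EuclideanSpace.single i 1) i * gaussWeight g := by
    intro i
    refine (integrable_gaussWeight (d := d)).bdd_mul (hm i).aestronglyMeasurable (c := K)
      (Filter.Eventually.of_forall fun g => ?_)
    refine (hcb i _).trans (((A g).le_opNorm _).trans ?_)
    simpa using hK g
  have i2 : ∀ i, Integrable fun g => h g i * (gaussWeight g * g i) := by
    intro i
    have : Integrable fun g : Ed d => gaussWeight g * g i := by
      refine integrable_norm_mul_gaussWeight.mono'
        ((continuous_gaussWeight.mul (by fun_prop)).aestronglyMeasurable)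
        (Filter.Eventually.of_forall fun g => ?_)
      rw [norm_mul, Real.norm_of_nonneg (gaussWeight_pos g).le, mul_comm]
      exact mul_le_mul_of_nonneg_right (hcb i g) (gaussWeight_pos g).le
    exact this.bdd_mul (by fun_prop) (c := R)
      (Filter.Eventually.of_forall fun g => (hcb i _).trans (hR g))
  have i3 : ∀ i, Integrable fun g => h g i * gaussWeight g := fun i =>
    integrable_gaussWeight.bdd_mul (by fun_prop) (c := R)
      (Filter.Eventually.of_forall fun g => (hcb i _).trans (hR g))
  have key : ∀ i, ∫ g, h g i * (gaussWeight g * g i) =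
      ∫ g, A g (EuclideanSpace.single i 1) i * gaussWeight g := by
    intro i
    have := integral_mul_fderiv_eq_neg_fderiv_mul_of_integrable (μ := volume)
      (f := fun g => h g i) (g := gaussWeight) (v := EuclideanSpace.single i 1)
      (by simpa only [e1] using i1 i) (by simp only [e2, mul_neg]; exact (i2 i).neg) (i3 i)
      (fun g _ => (hcoord i g).differentiableAt)
      (fun g _ => (hasFDerivAt_gaussWeight g).differentiableAt)
    simp only [e1, e2, mul_neg, integral_neg] at this
    exact neg_injective this
  calc ∫ g, gaussWeight g * inner ℝ g (h g)
      = ∫ g, ∑ i, h g i * (gaussWeight g * g i) := by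
        refine integral_congr_ae (Filter.Eventually.of_forall fun g => ?_)
        simp only [PiLp.inner_apply, Finset.mul_sum]
        exact Finset.sum_congr rfl fun i _ => by simp; ring
    _ = ∑ i, ∫ g, A g (EuclideanSpace.single i 1) i * gaussWeight g := by
        rw [integral_finsetSum _ fun i _ => i2 i]
        exact Finset.sum_congr rfl fun i _ => key i
    _ = _ := by
        rw [← integral_finsetSum _ fun i _ => i1 i]
        refine integral_congr_ae (Filter.Eventually.of_forall fun g => ?_)
        simp only [Finset.mul_sum]
        exact Finset.sum_congr rfl fun i _ => mul_comm _ _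

end Gaussian

section GaussianShift

variable {d : ℕ}

/-- Entropic cost of a bounded, nearly rigid shift of the standard Gaussian noise. -/
lemma entropyDualLE_map_stdGaussian {T : Ed d → Ed d} {A : Ed d → Ed d →L[ℝ] Ed d}
    (hinj : Function.Injective T) (hT : ∀ g, HasFDerivAt T (1 + A g) g) {R α : ℝ}
    (hR : ∀ g, ‖T g - g‖ ≤ R) (hA : ∀ g, ‖A g‖ ≤ 1 / 4) (hα : ∀ g, frobNorm (A g) ≤ α) :
    EntropyDualLE ((stdGaussian d).map T) (stdGaussian d) (R ^ 2 / 2 + 4 * α ^ 2) := by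
  rintro φ hφ ⟨M, hM⟩
  have hTc : Continuous T := continuous_iff_continuousAt.2 fun g => (hT g).continuousAt
  rw [integral_map hTc.aemeasurable hφ.aestronglyMeasurable]
  have hh : ∀ g, HasFDerivAt (fun g => T g - g) (A g) g := fun g => by
    have := (hT g).sub (hasFDerivAt_id g)
    rwa [← ContinuousLinearMap.one_def, add_sub_cancel_left] at this
  have hAf : ∀ g, A g = fderiv ℝ (fun g => T g - g) g := fun g => (hh g).fderiv.symm
  have hcb : ∀ i (v : Ed d), |v i| ≤ ‖v‖ := fun i v => by
    simpa using PiLp.norm_apply_le v i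
  let tr : Ed d → ℝ := fun g => ∑ i, A g (EuclideanSpace.single i 1) i
  have htrm : Measurable tr := by
    refine Finset.measurable_fun_sum _ fun i _ => ?_
    simp_rw [hAf]
    exact (EuclideanSpace.proj i : Ed d →L[ℝ] ℝ).measurable.comp
      (measurable_fderiv_apply_const ℝ _ _)
  have htrb : ∀ g, |tr g| ≤ ∑ _i : Fin d, (1 / 4 : ℝ) := fun g => by
    refine (Finset.abs_sum_le_sum_abs _ _).trans (Finset.sum_le_sum fun i _ => ?_)
    refine (hcb i _).trans (((A g).le_opNorm _).trans ?_)
    simpa using hA g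
  have itr : Integrable tr (stdGaussian d) := integrable_of_abs_le htrm htrb
  let ip : Ed d → ℝ := fun g => inner ℝ g (T g - g)
  have iip : Integrable ip (stdGaussian d) := by
    rw [integrable_stdGaussian_iff]
    refine (integrable_norm_mul_gaussWeight.mul_const R).mono'
      ((continuous_gaussWeight.mul (by fun_prop)).aestronglyMeasurable)
      (Filter.Eventually.of_forall fun g => ?_)
    rw [norm_mul, Real.norm_of_nonneg (gaussWeight_pos g).le]
    calc gaussWeight g * ‖ip g‖ ≤ gaussWeight g * (‖g‖ * R) := by
          gcongr
          · exact (gaussWeight_pos g).le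
          · exact (abs_real_inner_le_norm _ _).trans (by gcongr; exact hR g)
      _ = ‖g‖ * gaussWeight g * R := by ring
  have iφ : Integrable (fun g => φ (T g)) (stdGaussian d) :=
    integrable_of_abs_le (hφ.comp hTc.measurable) fun g => hM _
  have hibp : ∫ g, ip g ∂stdGaussian d = ∫ g, tr g ∂stdGaussian d :=
    integral_inner_stdGaussian hh hR hA
  let ψ : Ed d → ℝ := fun g => φ (T g) + (tr g - ip g) - (R ^ 2 / 2 + 4 * α ^ 2)
  have iψ : Integrable ψ (stdGaussian d) := (iφ.add (itr.sub iip)).sub (integrable_const _)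
  have hψ : ∫ g, ψ g ∂stdGaussian d =
      ∫ g, φ (T g) ∂stdGaussian d - (R ^ 2 / 2 + 4 * α ^ 2) := by
    have h1 : ∫ g, ψ g ∂stdGaussian d =
        ∫ g, (φ (T g) + (tr g - ip g)) ∂stdGaussian d -
          ∫ _g, (R ^ 2 / 2 + 4 * α ^ 2) ∂stdGaussian d :=
      integral_sub (iφ.add (itr.sub iip)) (integrable_const _)
    have h2 : ∫ g, (φ (T g) + (tr g - ip g)) ∂stdGaussian d =
        ∫ g, φ (T g) ∂stdGaussian d + ∫ g, (tr g - ip g) ∂stdGaussian d :=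
      integral_add iφ (itr.sub iip)
    rw [h1, h2, integral_sub itr iip, hibp]
    simp
  -- the change of variables
  let F : Ed d → ℝ := fun y => gaussWeight y * rexp (φ y)
  have iF : Integrable F :=
    integrable_stdGaussian_iff.1 (integrable_exp_of_abs_le hφ hM)
  have iJF : Integrable fun g => |(1 + A g).det| • F (T g) := by
    have := (integrableOn_image_iff_integrableOn_abs_det_fderiv_smul volume MeasurableSet.univ
      (fun g _ => (hT g).hasFDerivWithinAt) hinj.injOn F).1 iF.integrableOn
    rwa [integrableOn_univ] at this
  have hcv : ∫ g, |(1 + A g).det| • F (T g) ≤ ∫ y, F y := by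
    have := integral_image_eq_integral_abs_det_fderiv_smul volume MeasurableSet.univ
      (fun g _ => (hT g).hasFDerivWithinAt) hinj.injOn F
    rw [Measure.restrict_univ] at this
    rw [← this]
    exact setIntegral_le_integral iF
      (Filter.Eventually.of_forall fun y => mul_nonneg (gaussWeight_pos y).le (exp_pos _).le)
  have hpt : ∀ g, gaussWeight g * rexp (ψ g) ≤ |(1 + A g).det| • F (T g) := by
    intro g
    obtain ⟨hdet, hlog⟩ := abs_det_pos_and_log_ge (hA g)
    rw [smul_eq_mul, ← exp_log hdet]
    simp only [F, gaussWeight, ← exp_add]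
    rw [exp_le_exp]
    have hsq : ‖T g‖ ^ 2 = ‖g‖ ^ 2 + 2 * ip g + ‖T g - g‖ ^ 2 := by
      have := norm_add_sq_real g (T g - g)
      rwa [add_sub_cancel] at this
    have hR2 : ‖T g - g‖ ^ 2 ≤ R ^ 2 := by gcongr; exact hR g
    have hα2 : frobNorm (A g) ^ 2 ≤ α ^ 2 := by
      have := hα g
      have := frobNorm_nonneg (A g)
      gcongr
    simp only [ψ, hsq]
    have : tr g - 4 * frobNorm (A g) ^ 2 ≤ log |(1 + A g).det| := hlog
    linarith
  have hψm : AEStronglyMeasurable (fun g => rexp (ψ g)) volume := by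
    have : Measurable ψ := ((hφ.comp hTc.measurable).add
      (htrm.sub (by fun_prop))).sub measurable_const
    exact this.exp.aestronglyMeasurable
  have ieψ' : Integrable fun g => gaussWeight g * rexp (ψ g) :=
    iJF.mono' (continuous_gaussWeight.aestronglyMeasurable.mul hψm)
      (Filter.Eventually.of_forall fun g => by
        rw [Real.norm_of_nonneg (mul_nonneg (gaussWeight_pos g).le (exp_pos _).le)]
        exact hpt g)
  have ieψ : Integrable (fun g => rexp (ψ g)) (stdGaussian d) := integrable_stdGaussian_iff.2 ieψ'
  have hfin : ∫ g, rexp (ψ g) ∂stdGaussian d ≤ ∫ g, rexp (φ g) ∂stdGaussian d := by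
    rw [integral_stdGaussian, integral_stdGaussian]
    have := integral_gaussWeight_pos (d := d)
    exact mul_le_mul_of_nonneg_left ((integral_mono ieψ' iJF hpt).trans hcv)
      (inv_nonneg.2 this.le)
  have hJ := integral_le_log_integral_exp iψ ieψ
  have hlog := log_le_log (integral_exp_pos ieψ) hfin
  linarith

/-- Entropic cost of a constant shift of the standard Gaussian noise. -/
lemma entropyDualLE_map_add_const (c : Ed d) :
    EntropyDualLE ((stdGaussian d).map fun g => g + c) (stdGaussian d) (‖c‖ ^ 2 / 2) := by
  have := entropyDualLE_map_stdGaussian (d := d) (T := fun g => g + c) (A := fun _ => 0)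
    (R := ‖c‖) (α := 0) (add_left_injective c)
    (fun g => by
      have := (hasFDerivAt_id (𝕜 := ℝ) g).add_const c
      simpa [ContinuousLinearMap.one_def] using this)
    (fun g => by simp) (fun g => by simp) (fun g => by simp [frobNorm])
  simpa using this

end GaussianShift

section SecondOrder

/-- Growth estimates for curves whose acceleration is bounded by their position, up to an
additive error. -/
lemma second_order_growth {E : Type*} [NormedAddCommGroup E] [NormedSpace ℝ E]
    {y w a : ℝ → E} {t κ : ℝ} (ht0 : 0 ≤ t) (ht : t ≤ 1 / 8)
    (hy : ∀ s ∈ Icc 0 t, HasDerivWithinAt y (w s) (Icc 0 t) s)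
    (hw : ∀ s ∈ Icc 0 t, HasDerivWithinAt w (a s) (Icc 0 t) s)
    (ha : ∀ s ∈ Icc 0 t, ‖a s‖ ≤ ‖y s‖ + κ) :
    ∃ m, m ≤ 64 / 63 * (‖y 0‖ + t * ‖w 0‖ + t ^ 2 * κ) ∧ ∀ s ∈ Icc 0 t,
      ‖y s‖ ≤ m ∧ ‖w s - w 0‖ ≤ t * (m + κ) ∧ ‖y s - y 0 - s • w 0‖ ≤ t ^ 2 * (m + κ) := by
  have h0 : (0 : ℝ) ∈ Icc 0 t := ⟨le_rfl, ht0⟩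
  obtain ⟨s₀, hs₀, hmax⟩ := isCompact_Icc.exists_isMaxOn ⟨0, h0⟩
    (f := fun s => ‖y s‖) (fun s hs => (hy s hs).continuousWithinAt.norm)
  have hm : ∀ s ∈ Icc 0 t, ‖y s‖ ≤ ‖y s₀‖ := fun s hs => hmax hs
  set m := ‖y s₀‖ with hmdef
  have hmκ : 0 ≤ m + κ := (norm_nonneg _).trans (ha s₀ hs₀)
  have hw' : ∀ s ∈ Icc 0 t, ‖w s - w 0‖ ≤ t * (m + κ) := fun s hs => by
    have := norm_image_sub_le_of_norm_deriv_le_segment' hw (C := m + κ)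
      (fun r hr => (ha r (Ico_subset_Icc_self hr)).trans
        (by linarith [hm r (Ico_subset_Icc_self hr)])) s hs
    refine this.trans ?_
    rw [mul_comm]
    gcongr
    linarith [hs.2]
  have hz : ∀ s ∈ Icc 0 t, HasDerivWithinAt (fun s => y s - s • w 0) (w s - w 0) (Icc 0 t) s :=
    fun s hs => by
      have := (hy s hs).sub ((hasDerivWithinAt_id s (Icc 0 t)).smul_const (w 0))
      rwa [one_smul] at this
  have hy' : ∀ s ∈ Icc 0 t, ‖y s - y 0 - s • w 0‖ ≤ t ^ 2 * (m + κ) := fun s hs => by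
    have := norm_image_sub_le_of_norm_deriv_le_segment' hz (C := t * (m + κ))
      (fun r hr => hw' r (Ico_subset_Icc_self hr)) s hs
    have e : y s - s • w 0 - (y 0 - (0 : ℝ) • w 0) = y s - y 0 - s • w 0 := by
      rw [zero_smul]; abel
    rw [e] at this
    refine this.trans ?_
    calc t * (m + κ) * (s - 0) ≤ t * (m + κ) * t := by gcongr; linarith [hs.2]
      _ = t ^ 2 * (m + κ) := by ring
  refine ⟨m, ?_, fun s hs => ⟨hm s hs, hw' s hs, hy' s hs⟩⟩
  have h1 : m ≤ ‖y 0‖ + t * ‖w 0‖ + t ^ 2 * (m + κ) := by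
    have e : y s₀ = y 0 + s₀ • w 0 + (y s₀ - y 0 - s₀ • w 0) := by abel
    have h2 : ‖s₀ • w 0‖ ≤ t * ‖w 0‖ := by
      rw [norm_smul, Real.norm_of_nonneg hs₀.1]; gcongr; exact hs₀.2
    calc m = ‖y 0 + s₀ • w 0 + (y s₀ - y 0 - s₀ • w 0)‖ := by rw [hmdef, e]; congr 1; abel
      _ ≤ ‖y 0‖ + ‖s₀ • w 0‖ + ‖y s₀ - y 0 - s₀ • w 0‖ := norm_add₃_le
      _ ≤ _ := by linarith [hy' s₀ hs₀]
  have h3 : t ^ 2 * m ≤ 1 / 64 * m := by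
    gcongr
    nlinarith
  nlinarith

end SecondOrder

section FrobeniusNorm

variable {d : ℕ}

lemma frobNorm_le_of_sq_le {A : Ed d →L[ℝ] Ed d} {c : ℝ} (hc : 0 ≤ c)
    (h : ∑ j, ‖A (EuclideanSpace.single j 1)‖ ^ 2 ≤ c ^ 2) : frobNorm A ≤ c := by
  rw [← frobNorm_sq_eq_sum_norm_sq] at h
  exact (abs_le.1 (abs_le_of_sq_le_sq h hc)).2

lemma frobNorm_comp_le_opNorm_mul (A B : Ed d →L[ℝ] Ed d) :
    frobNorm (A.comp B) ≤ ‖A‖ * frobNorm B := by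
  have hB := frobNorm_nonneg B
  refine frobNorm_le_of_sq_le (by positivity) ?_
  rw [mul_pow, frobNorm_sq_eq_sum_norm_sq, Finset.mul_sum]
  refine Finset.sum_le_sum fun j _ => ?_
  rw [← mul_pow]
  gcongr
  exact A.le_opNorm _

lemma frobNorm_adjoint (A : Ed d →L[ℝ] Ed d) :
    frobNorm (ContinuousLinearMap.adjoint A) = frobNorm A := by
  rw [frobNorm, frobNorm, Finset.sum_comm]
  congr 1
  refine Finset.sum_congr rfl fun j _ => Finset.sum_congr rfl fun i _ => ?_
  have h := ContinuousLinearMap.adjoint_inner_right A (EuclideanSpace.single i (1 : ℝ))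
    (EuclideanSpace.single j 1)
  rw [EuclideanSpace.inner_single_left, EuclideanSpace.inner_single_right] at h
  simp at h
  rw [h]

lemma frobNorm_comp_le_mul_opNorm (A B : Ed d →L[ℝ] Ed d) :
    frobNorm (A.comp B) ≤ frobNorm A * ‖B‖ := by
  rw [← frobNorm_adjoint, ContinuousLinearMap.adjoint_comp, ← frobNorm_adjoint A, mul_comm,
    ← (ContinuousLinearMap.adjoint : (Ed d →L[ℝ] Ed d) ≃ₗᵢ⋆[ℝ] _).norm_map B]
  exact frobNorm_comp_le_opNorm_mul _ _

lemma opNorm_le_frobNorm (A : Ed d →L[ℝ] Ed d) : ‖A‖ ≤ frobNorm A := by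
  refine A.opNorm_le_bound (frobNorm_nonneg _) fun v => ?_
  have hv : v = ∑ j, v j • EuclideanSpace.single j (1 : ℝ) := by
    simpa using ((EuclideanSpace.basisFun (Fin d) ℝ).sum_repr v).symm
  have h1 : ‖A v‖ ≤ ∑ j, |v j| * ‖A (EuclideanSpace.single j 1)‖ := by
    conv_lhs => rw [hv, map_sum]
    refine (norm_sum_le _ _).trans (Finset.sum_le_sum fun j _ => ?_)
    rw [map_smul, norm_smul, Real.norm_eq_abs]
  have h2 := frobNorm_nonneg A
  refine h1.trans ((sq_le_sq₀ (by positivity) (by positivity)).1 ?_)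
  refine (Finset.sum_mul_sq_le_sq_mul_sq _ _ _).trans_eq ?_
  rw [mul_pow, frobNorm_sq_eq_sum_norm_sq, EuclideanSpace.norm_sq_eq, mul_comm]
  simp

/-- The Frobenius norm as a Euclidean norm on columns. -/
noncomputable def columnsCLM (d : ℕ) :
    (Ed d →L[ℝ] Ed d) →L[ℝ] PiLp 2 (fun _ : Fin d => Ed d) :=
  (PiLp.continuousLinearEquiv 2 ℝ (fun _ : Fin d => Ed d)).symm.toContinuousLinearMap.comp
    (ContinuousLinearMap.pi fun j => ContinuousLinearMap.apply ℝ (Ed d) (EuclideanSpace.single j 1))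

lemma norm_columnsCLM (A : Ed d →L[ℝ] Ed d) : ‖columnsCLM d A‖ = frobNorm A := by
  have h : ‖columnsCLM d A‖ ^ 2 = frobNorm A ^ 2 := by
    rw [PiLp.norm_sq_eq_of_L2, frobNorm_sq_eq_sum_norm_sq]
    rfl
  exact (sq_eq_sq₀ (norm_nonneg _) (frobNorm_nonneg _)).1 h

end FrobeniusNorm

section NewtonFlow

variable {d : ℕ}

/-- `Φ` is the flow of `ẍ = -F(x)`, where `F` is `1`-Lipschitz and its derivative is
`LH`-Lipschitz in Frobenius norm. -/
structure IsNewtonFlow (F : Ed d → Ed d) (LH : ℝ) (Φ : ℝ → Phase d → Phase d) : Prop where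
  differentiable : Differentiable ℝ F
  norm_fderiv_le : ∀ x, ‖fderiv ℝ F x‖ ≤ 1
  frobNorm_sub_le : ∀ x x', frobNorm (fderiv ℝ F x - fderiv ℝ F x') ≤ LH * ‖x - x'‖
  nonneg : 0 ≤ LH
  zero : ∀ z, Φ 0 z = z
  hasDerivAt : ∀ z s, HasDerivAt (fun u => Φ u z) ((Φ s z).2, -F (Φ s z).1) s

namespace IsNewtonFlow

variable {F : Ed d → Ed d} {LH : ℝ} {Φ : ℝ → Phase d → Phase d} {t : ℝ}

lemma norm_map_sub_le (h : IsNewtonFlow F LH Φ) (x x' : Ed d) : ‖F x' - F x‖ ≤ ‖x' - x‖ := by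
  simpa using convex_univ.norm_image_sub_le_of_norm_fderiv_le (f := F) (C := 1) (x := x) (y := x')
    (fun y _ => h.differentiable y) (fun y _ => h.norm_fderiv_le y) (mem_univ _) (mem_univ _)

lemma norm_map_sub_sub_le (h : IsNewtonFlow F LH Φ) (x x' : Ed d) :
    ‖F x' - F x - fderiv ℝ F x (x' - x)‖ ≤ LH * ‖x' - x‖ ^ 2 := by
  have := (convex_closedBall x ‖x' - x‖).norm_image_sub_le_of_norm_fderiv_le' (f := F)
    (C := LH * ‖x' - x‖) (φ := fderiv ℝ F x) (x := x) (y := x')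
    (fun y _ => h.differentiable y) (fun y hy => ?_) (by simp) (by simp [dist_eq_norm])
  · rwa [sq, ← mul_assoc]
  · refine (opNorm_le_frobNorm _).trans ((h.frobNorm_sub_le _ _).trans ?_)
    rw [mem_closedBall_iff_norm] at hy
    exact mul_le_mul_of_nonneg_left hy h.nonneg

lemma hasDerivAt_fst (h : IsNewtonFlow F LH Φ) (z : Phase d) (s : ℝ) :
    HasDerivAt (fun u => (Φ u z).1) (Φ s z).2 s :=
  (hasFDerivAt_fst (𝕜 := ℝ) (E := Ed d) (F := Ed d)).comp_hasDerivAt s (h.hasDerivAt z s)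

lemma hasDerivAt_snd (h : IsNewtonFlow F LH Φ) (z : Phase d) (s : ℝ) :
    HasDerivAt (fun u => (Φ u z).2) (-F (Φ s z).1) s :=
  (hasFDerivAt_snd (𝕜 := ℝ) (E := Ed d) (F := Ed d)).comp_hasDerivAt s (h.hasDerivAt z s)

lemma sub_growth (h : IsNewtonFlow F LH Φ) (ht0 : 0 ≤ t) (ht : t ≤ 1 / 8) (z z' : Phase d) :
    ∃ m, m ≤ 64 / 63 * (‖z'.1 - z.1‖ + t * ‖z'.2 - z.2‖) ∧ ∀ s ∈ Icc 0 t,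
      ‖(Φ s z').1 - (Φ s z).1‖ ≤ m ∧ ‖(Φ s z').2 - (Φ s z).2 - (z'.2 - z.2)‖ ≤ t * m ∧
      ‖(Φ s z').1 - (Φ s z).1 - (z'.1 - z.1) - s • (z'.2 - z.2)‖ ≤ t ^ 2 * m := by
  have := second_order_growth (y := fun s => (Φ s z').1 - (Φ s z).1) (κ := 0) ht0 ht
    (fun s _ => ((h.hasDerivAt_fst z' s).sub (h.hasDerivAt_fst z s)).hasDerivWithinAt)
    (fun s _ => ((h.hasDerivAt_snd z' s).sub (h.hasDerivAt_snd z s)).hasDerivWithinAt)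
    (fun s _ => by
      rw [add_zero, ← neg_sub', norm_neg]
      exact h.norm_map_sub_le _ _)
  simpa [h.zero] using this

lemma lipschitzWith (h : IsNewtonFlow F LH Φ) (ht0 : 0 ≤ t) (ht : t ≤ 1 / 8) :
    LipschitzWith 2 (Φ t) := by
  refine LipschitzWith.of_dist_le_mul fun z' z => ?_
  obtain ⟨m, hm, hs⟩ := h.sub_growth ht0 ht z z'
  obtain ⟨h1, h2, -⟩ := hs t ⟨ht0, le_rfl⟩
  rw [dist_eq_norm, dist_eq_norm]
  have e1 : ‖z'.1 - z.1‖ ≤ ‖z' - z‖ := norm_fst_le (z' - z)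
  have e2 : ‖z'.2 - z.2‖ ≤ ‖z' - z‖ := norm_snd_le (z' - z)
  have hm' : m ≤ 2 * ‖z' - z‖ := by nlinarith [norm_nonneg (z' - z), norm_nonneg (z'.2 - z.2)]
  have hm0 : 0 ≤ m := (norm_nonneg _).trans h1
  refine norm_prod_le_iff.2 ⟨h1.trans hm', ?_⟩
  have h3 := norm_add_le ((Φ t z').2 - (Φ t z).2 - (z'.2 - z.2)) (z'.2 - z.2)
  rw [sub_add_cancel] at h3
  refine h3.trans ?_
  push_cast
  nlinarith

/-- The position after time `t` as a function of the initial velocity. -/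
lemma norm_position_sub_le (h : IsNewtonFlow F LH Φ) (ht0 : 0 ≤ t) (ht : t ≤ 1 / 8)
    (x u u' : Ed d) :
    ‖(Φ t (x, u')).1 - (Φ t (x, u)).1 - t • (u' - u)‖ ≤ t / 63 * ‖u' - u‖ := by
  obtain ⟨m, hm, hs⟩ := h.sub_growth ht0 ht (x, u) (x, u')
  have h1 := (hs t ⟨ht0, le_rfl⟩).2.2
  simp only [sub_self, norm_zero, zero_add, sub_zero] at h1 hm
  have : t ^ 2 * m ≤ 1 / 64 * m := by
    have hm0 : 0 ≤ m := (norm_nonneg _).trans (hs t ⟨ht0, le_rfl⟩).1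
    gcongr
    nlinarith
  linarith

lemma exists_jacobi {K : ℝ → Ed d →L[ℝ] Ed d} (hK : Continuous K) (hK1 : ∀ s, ‖K s‖ ≤ 1)
    (ht0 : 0 ≤ t) (ht : t ≤ 1 / 8) :
    ∃ Y W : ℝ → Ed d →L[ℝ] Ed d, Y 0 = 0 ∧ W 0 = 1 ∧
      (∀ s ∈ Icc 0 t, HasDerivWithinAt Y (W s) (Icc 0 t) s) ∧
      ∀ s ∈ Icc 0 t, HasDerivWithinAt W (-(K s ∘L Y s)) (Icc 0 t) s := by
  have hPL : IsPicardLindelof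
      (fun s (p : (Ed d →L[ℝ] Ed d) × (Ed d →L[ℝ] Ed d)) => (p.2, -(K s ∘L p.1)))
      (tmin := 0) (tmax := t) ⟨0, le_rfl, ht0⟩ (0, 1) 1 0 2 1 := by
    have hlin : ∀ s (p : (Ed d →L[ℝ] Ed d) × (Ed d →L[ℝ] Ed d)),
        ‖(p.2, -(K s ∘L p.1))‖ ≤ ‖p‖ := fun s p => by
      refine norm_prod_le_iff.2 ⟨norm_snd_le p, ?_⟩
      rw [norm_neg]
      refine ((K s).opNorm_comp_le p.1).trans ?_
      have := hK1 s
      have := norm_fst_le p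
      nlinarith [norm_nonneg p.1]
    refine ⟨fun s _ => ?_, fun p _ => ?_, fun s _ p hp => (hlin s p).trans ?_, ?_⟩
    · refine LipschitzOnWith.of_dist_le_mul fun p _ q _ => ?_
      rw [dist_eq_norm, dist_eq_norm, NNReal.coe_one, one_mul]
      refine le_of_eq_of_le ?_ (hlin s (p - q))
      congr 1
      ext1
      · rfl
      · simp only [Prod.snd_sub, Prod.fst_sub, ContinuousLinearMap.comp_sub]; abel
    · fun_prop
    · rw [mem_closedBall_iff_norm] at hp
      have h1 : ‖((0 : Ed d →L[ℝ] Ed d), (1 : Ed d →L[ℝ] Ed d))‖ ≤ 1 :=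
        norm_prod_le_iff.2 ⟨by simp, ContinuousLinearMap.norm_id_le⟩
      have := norm_le_norm_add_norm_sub' p ((0 : Ed d →L[ℝ] Ed d), (1 : Ed d →L[ℝ] Ed d))
      push_cast at hp ⊢
      linarith
    · simp only [NNReal.coe_ofNat, sub_zero, sub_self, NNReal.coe_one, NNReal.coe_zero]
      rw [max_eq_left ht0]
      linarith
  obtain ⟨α, hα0, hα⟩ := hPL.exists_eq_forall_mem_Icc_hasDerivWithinAt₀
  refine ⟨fun s => (α s).1, fun s => (α s).2, by simp [hα0], by simp [hα0], fun s hs => ?_,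
    fun s hs => ?_⟩
  · exact (hasFDerivAt_fst (p := α s)).comp_hasDerivWithinAt s (hα s hs)
  · exact (hasFDerivAt_snd (p := α s)).comp_hasDerivWithinAt s (hα s hs)

lemma continuous_fderiv (h : IsNewtonFlow F LH Φ) : Continuous (fderiv ℝ F) := by
  have : LipschitzWith ⟨LH, h.nonneg⟩ (fderiv ℝ F) := LipschitzWith.of_dist_le_mul fun x x' => by
    rw [dist_eq_norm, dist_eq_norm]
    exact (opNorm_le_frobNorm _).trans (h.frobNorm_sub_le x x')
  exact this.continuous

lemma continuous_position (h : IsNewtonFlow F LH Φ) (z : Phase d) :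
    Continuous fun s => (Φ s z).1 :=
  continuous_iff_continuousAt.2 fun s => (h.hasDerivAt_fst z s).continuousAt

/-- `Y` is the Jacobi field, i.e. the derivative of the position with respect to the initial
velocity, along the trajectory of `z` up to time `t`, with derivative `W`. -/
def _root_.IsJacobi (F : Ed d → Ed d) (Φ : ℝ → Phase d → Phase d) (t : ℝ) (z : Phase d)
    (Y W : ℝ → Ed d →L[ℝ] Ed d) : Prop :=
  Y 0 = 0 ∧ W 0 = 1 ∧ (∀ s ∈ Icc 0 t, HasDerivWithinAt Y (W s) (Icc 0 t) s) ∧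
    ∀ s ∈ Icc 0 t, HasDerivWithinAt W (-(fderiv ℝ F (Φ s z).1 ∘L Y s)) (Icc 0 t) s

lemma exists_isJacobi (h : IsNewtonFlow F LH Φ) (ht0 : 0 ≤ t) (ht : t ≤ 1 / 8) (z : Phase d) :
    ∃ Y W, IsJacobi F Φ t z Y W :=
  exists_jacobi (h.continuous_fderiv.comp (h.continuous_position z))
    (fun _ => h.norm_fderiv_le _) ht0 ht

lemma isJacobi_bounds (h : IsNewtonFlow F LH Φ) (ht0 : 0 ≤ t) (ht : t ≤ 1 / 8) {z : Phase d}
    {Y W : ℝ → Ed d →L[ℝ] Ed d} (hY : IsJacobi F Φ t z Y W) :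
    (∀ s ∈ Icc 0 t, ‖Y s‖ ≤ 64 / 63 * t) ∧ ‖Y t - t • 1‖ ≤ t / 63 := by
  obtain ⟨hY0, hW0, hY', hW'⟩ := hY
  obtain ⟨m, hm, hs⟩ := second_order_growth (κ := 0) ht0 ht hY' hW' (fun s _ => by
    rw [norm_neg, add_zero]
    refine (ContinuousLinearMap.opNorm_comp_le _ _).trans ?_
    have := h.norm_fderiv_le (Φ s z).1
    nlinarith [norm_nonneg (Y s)])
  have h1 : ‖(1 : Ed d →L[ℝ] Ed d)‖ ≤ 1 := ContinuousLinearMap.norm_id_le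
  rw [hY0, hW0, norm_zero] at hm
  have hm1 : m ≤ 64 / 63 * t := by nlinarith
  refine ⟨fun s hs' => (hs s hs').1.trans hm1, ?_⟩
  have h2 := (hs t ⟨ht0, le_rfl⟩).2.2
  rw [hY0, hW0, sub_zero, add_zero] at h2
  have h3 : t ^ 2 * m ≤ 1 / 64 * m := by
    have hm0 : 0 ≤ m := (norm_nonneg _).trans (hs t ⟨ht0, le_rfl⟩).1
    gcongr
    nlinarith
  linarith

lemma hasFDerivAt_position (h : IsNewtonFlow F LH Φ) (ht0 : 0 ≤ t) (ht : t ≤ 1 / 8) {x u : Ed d}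
    {Y W : ℝ → Ed d →L[ℝ] Ed d} (hY : IsJacobi F Φ t (x, u) Y W) :
    HasFDerivAt (fun u => (Φ t (x, u)).1) (Y t) u := by
  obtain ⟨hY0, hW0, hY', hW'⟩ := hY
  have key : ∀ u', ‖(Φ t (x, u')).1 - (Φ t (x, u)).1 - Y t (u' - u)‖ ≤
      LH * ‖u' - u‖ ^ 2 := by
    intro u'
    obtain ⟨m, hm, hs⟩ := h.sub_growth ht0 ht (x, u) (x, u')
    simp only [sub_self, norm_zero, zero_add] at hm
    have hm0 : 0 ≤ m := (norm_nonneg _).trans (hs t ⟨ht0, le_rfl⟩).1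
    have hm1 : m ≤ ‖u' - u‖ := by nlinarith [norm_nonneg (u' - u)]
    have hLH := h.nonneg
    obtain ⟨m', hm', hs'⟩ := second_order_growth (κ := LH * ‖u' - u‖ ^ 2) ht0 ht
      (y := fun s => (Φ s (x, u')).1 - (Φ s (x, u)).1 - Y s (u' - u))
      (fun s hs => ((h.hasDerivAt_fst (x, u') s).sub
        (h.hasDerivAt_fst (x, u) s)).hasDerivWithinAt.sub
        ((ContinuousLinearMap.apply ℝ (Ed d) (u' - u)).hasFDerivAt.comp_hasDerivWithinAt s
          (hY' s hs)))
      (fun s hs => ((h.hasDerivAt_snd (x, u') s).sub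
        (h.hasDerivAt_snd (x, u) s)).hasDerivWithinAt.sub
        ((ContinuousLinearMap.apply ℝ (Ed d) (u' - u)).hasFDerivAt.comp_hasDerivWithinAt s
          (hW' s hs)))
      (fun s hs'' => by
        set q := (Φ s (x, u')).1
        set p := (Φ s (x, u)).1
        have e : -F q - -F p - (ContinuousLinearMap.apply ℝ (Ed d) (u' - u))
            (-(fderiv ℝ F p ∘L Y s)) =
            -(fderiv ℝ F p (q - p - Y s (u' - u)) + (F q - F p - fderiv ℝ F p (q - p))) := by
          simp only [ContinuousLinearMap.apply_apply, neg_apply, ContinuousLinearMap.comp_apply]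
          simp only [map_sub]
          abel
        rw [e, norm_neg]
        refine (norm_add_le _ _).trans (add_le_add ?_ ((h.norm_map_sub_sub_le p q).trans ?_))
        · refine ((fderiv ℝ F p).le_opNorm _).trans ?_
          have := h.norm_fderiv_le p
          nlinarith [norm_nonneg (q - p - Y s (u' - u))]
        · have := (hs s hs'').1.trans hm1
          gcongr)
    have h1 := (hs' t ⟨ht0, le_rfl⟩).1.trans hm'
    refine h1.trans ?_
    simp only [h.zero, hY0, hW0, sub_self, zero_apply,
      ContinuousLinearMap.apply_apply, one_apply_eq_self, norm_zero, mul_zero, zero_add]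
    have h2 : t ^ 2 * (LH * ‖u' - u‖ ^ 2) ≤ 1 / 64 * (LH * ‖u' - u‖ ^ 2) := by
      gcongr
      nlinarith
    have : 0 ≤ LH * ‖u' - u‖ ^ 2 := by positivity
    linarith
  have hO : HasFDerivAt (fun u' => (Φ t (x, u')).1 - (Φ t (x, u)).1 - Y t (u' - u))
      (0 : Ed d →L[ℝ] Ed d) u := by
    refine (Asymptotics.IsBigO.of_bound LH (Filter.Eventually.of_forall fun u' => ?_)).hasFDerivAt
      (n := 2) one_lt_two
    rw [norm_pow, norm_norm]
    exact key u'
  have h2 := (hO.add ((Y t).hasFDerivAt.comp u ((hasFDerivAt_id u).sub_const u))).add_const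
    (Φ t (x, u)).1
  rw [zero_add] at h2
  refine h2.congr_of_eventuallyEq (Filter.Eventually.of_forall fun u' => ?_)
  simp

lemma frobNorm_jacobi_sub_le (h : IsNewtonFlow F LH Φ) (ht0 : 0 ≤ t) (ht : t ≤ 1 / 8)
    {z z' : Phase d} {Y W Y' W' : ℝ → Ed d →L[ℝ] Ed d} (hY : IsJacobi F Φ t z Y W)
    (hY' : IsJacobi F Φ t z' Y' W') {m : ℝ}
    (hm : ∀ s ∈ Icc 0 t, ‖(Φ s z').1 - (Φ s z).1‖ ≤ m) :
    frobNorm (Y t - Y' t) ≤ 1.04 * t ^ 3 * LH * m := by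
  have hb := (h.isJacobi_bounds ht0 ht hY).1
  obtain ⟨hY0, hW0, hYd, hWd⟩ := hY
  obtain ⟨hY0', hW0', hYd', hWd'⟩ := hY'
  have hLH := h.nonneg
  have hm0 : 0 ≤ m := (norm_nonneg _).trans (hm 0 ⟨le_rfl, ht0⟩)
  obtain ⟨m', hm', hs'⟩ := second_order_growth (κ := LH * m * (64 / 63 * t)) ht0 ht
    (y := fun s => columnsCLM d (Y s - Y' s))
    (fun s hs => (columnsCLM d).hasFDerivAt.comp_hasDerivWithinAt s ((hYd s hs).sub (hYd' s hs)))
    (fun s hs => (columnsCLM d).hasFDerivAt.comp_hasDerivWithinAt s ((hWd s hs).sub (hWd' s hs)))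
    (fun s hs => by
      set K := fderiv ℝ F (Φ s z).1
      set K' := fderiv ℝ F (Φ s z').1
      have e : -(K ∘L Y s) - -(K' ∘L Y' s) =
          -(K' ∘L (Y s - Y' s)) + (K' - K) ∘L Y s := by
        simp only [ContinuousLinearMap.comp_sub, ContinuousLinearMap.sub_comp]; abel
      rw [e, map_add, map_neg]
      refine (norm_add_le _ _).trans ?_
      rw [norm_neg, norm_columnsCLM, norm_columnsCLM, norm_columnsCLM]
      refine add_le_add ((frobNorm_comp_le_opNorm_mul _ _).trans ?_)
        ((frobNorm_comp_le_mul_opNorm _ _).trans ?_)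
      · have := h.norm_fderiv_le (Φ s z').1
        have := frobNorm_nonneg (Y s - Y' s)
        nlinarith
      · have h1 := hm s hs
        have h2 := h.frobNorm_sub_le (Φ s z').1 (Φ s z).1
        have h3 := hb s hs
        have h4 : frobNorm (K' - K) ≤ LH * m := h2.trans (by gcongr)
        gcongr)
  have h1 := (hs' t ⟨ht0, le_rfl⟩).1.trans hm'
  rw [norm_columnsCLM] at h1
  refine h1.trans ?_
  simp only [hY0, hW0, hY0', hW0', sub_self, map_zero, norm_zero, mul_zero,
    zero_add]
  have : 0 ≤ t ^ 3 * LH * m := by positivity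
  nlinarith

end IsNewtonFlow
end NewtonFlow

section NewtonFlow

variable {d : ℕ}

/-- A linear map close to the identity is invertible. -/
lemma exists_continuousLinearEquiv_of_norm_sub_one_le {Z : Ed d →L[ℝ] Ed d}
    (hZ : ‖Z - 1‖ ≤ 1 / 63) :
    ∃ e : Ed d ≃L[ℝ] Ed d, (e : Ed d →L[ℝ] Ed d) = Z ∧
      ‖(e.symm : Ed d →L[ℝ] Ed d)‖ ≤ 63 / 62 := by
  have hlt : ‖1 - Z‖ < 1 := by rw [norm_sub_rev]; linarith
  refine ⟨ContinuousLinearEquiv.unitsEquiv ℝ (Ed d) (Units.oneSub (1 - Z) hlt), ?_, ?_⟩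
  · ext1 v
    simp
  · set e := ContinuousLinearEquiv.unitsEquiv ℝ (Ed d) (Units.oneSub (1 - Z) hlt) with he
    have hez : ∀ v, e v = Z v := fun v => by simp [he]
    refine ContinuousLinearMap.opNorm_le_bound _ (by norm_num) fun w => ?_
    have h1 := (Z - 1).le_of_opNorm_le hZ (e.symm w)
    have h2 : (Z - 1) (e.symm w) = w - e.symm w := by
      rw [sub_apply, ← hez, e.apply_symm_apply]; rfl
    rw [h2] at h1
    have h3 := norm_sub_norm_le (e.symm w) w
    rw [norm_sub_rev] at h3
    simp only [ContinuousLinearEquiv.coe_coe]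
    linarith

namespace IsNewtonFlow

variable {F : Ed d → Ed d} {LH : ℝ} {Φ : ℝ → Phase d → Phase d} {t : ℝ}

/-- The position after time `t`, rescaled by `t`, as a homeomorphism in the initial velocity. -/
lemma exists_homeomorph_position (h : IsNewtonFlow F LH Φ) (ht0 : 0 < t) (ht : t ≤ 1 / 8)
    (x : Ed d) : ∃ P : Ed d ≃ₜ Ed d, ∀ u, P u = t⁻¹ • (Φ t (x, u)).1 := by
  have hA : ApproximatesLinearOn (fun u => t⁻¹ • (Φ t (x, u)).1)
      ((ContinuousLinearEquiv.refl ℝ (Ed d) : Ed d ≃L[ℝ] Ed d) : Ed d →L[ℝ] Ed d) univ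
      (1 / 63) := by
    intro u' _ u _
    have h1 := h.norm_position_sub_le ht0.le ht x u u'
    have e : ∀ a b : Ed d, t⁻¹ • a - t⁻¹ • b - (u' - u) = t⁻¹ • (a - b - t • (u' - u)) :=
      fun a b => by
        rw [smul_sub, smul_sub, inv_smul_smul₀ ht0.ne']
    simp only [ContinuousLinearEquiv.coe_coe, ContinuousLinearEquiv.coe_refl', id]
    rw [e, norm_smul, norm_inv, Real.norm_of_nonneg ht0.le, inv_mul_le_iff₀ ht0]
    refine h1.trans_eq ?_
    push_cast
    ring
  have hc : Subsingleton (Ed d) ∨ (1 / 63 : NNReal) <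
      ‖((ContinuousLinearEquiv.refl ℝ (Ed d)).symm : Ed d →L[ℝ] Ed d)‖₊⁻¹ := by
    rcases subsingleton_or_nontrivial (Ed d) with hs | hs
    · exact Or.inl hs
    · right
      have : ‖((ContinuousLinearEquiv.refl ℝ (Ed d)).symm : Ed d →L[ℝ] Ed d)‖₊ = 1 := by
        ext; exact ContinuousLinearMap.norm_id
      rw [this, inv_one]
      rw [← NNReal.coe_lt_coe]; norm_num
  exact ⟨hA.toHomeomorph _ hc, fun u => rfl⟩

/-- Coupling of two trajectories by shifting the second initial velocity so that the final
positions differ by a prescribed vector. -/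
lemma exists_coupling (h : IsNewtonFlow F LH Φ) (ht0 : 0 < t) (ht : t ≤ 1 / 8) (x x' δ' w : Ed d)
    (hw : δ' = x' - x + t • w) {m : ℝ} (hm : 32 / 31 * (‖x' - x‖ + t * ‖w‖) ≤ m) :
    ∃ (S : Ed d → Ed d) (A : Ed d → Ed d →L[ℝ] Ed d), Function.Injective S ∧ ∀ u,
      (Φ t (x', S u)).1 = (Φ t (x, u)).1 + δ' ∧ HasFDerivAt S (1 + A u) u ∧ ‖A u‖ ≤ 1 / 4 ∧
      frobNorm (A u) ≤ 2 * t ^ 2 * LH * m ∧ ‖S u - u - w‖ ≤ t * m ∧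
      ‖(Φ t (x', S u)).2 - (Φ t (x, u)).2 - w‖ ≤ 2 * t * m := by
  obtain ⟨P, hP⟩ := h.exists_homeomorph_position ht0 ht x
  obtain ⟨P', hP'⟩ := h.exists_homeomorph_position ht0 ht x'
  let S : Ed d → Ed d := fun u => P'.symm (P u + t⁻¹ • δ')
  have hPS : ∀ u, P' (S u) = P u + t⁻¹ • δ' := fun u => P'.apply_symm_apply _
  have hpos : ∀ u, (Φ t (x', S u)).1 = (Φ t (x, u)).1 + δ' := fun u => by
    have := hPS u
    rw [hP, hP', ← smul_add] at this
    exact smul_right_injective _ (inv_ne_zero ht0.ne') this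
  have hinj : Function.Injective S := fun u u' huu => by
    have : P u + t⁻¹ • δ' = P u' + t⁻¹ • δ' := P'.symm.injective huu
    exact P.injective (add_right_cancel this)
  have hJ : ∀ u, ∃ A : Ed d →L[ℝ] Ed d, HasFDerivAt S (1 + A) u ∧ ‖A‖ ≤ 1 / 4 ∧
      frobNorm A ≤ 2 * t ^ 2 * LH * m ∧ ‖S u - u - w‖ ≤ t * m ∧
      ‖(Φ t (x', S u)).2 - (Φ t (x, u)).2 - w‖ ≤ 2 * t * m := by
    intro u
    obtain ⟨m₁, hm₁, hs⟩ := h.sub_growth ht0.le ht (x, u) (x', S u)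
    obtain ⟨-, hv, hx⟩ := hs t ⟨ht0.le, le_rfl⟩
    simp only at hm₁ hv hx
    have hm0 : 0 ≤ m₁ := (norm_nonneg _).trans (hs t ⟨ht0.le, le_rfl⟩).1
    have hSw : ‖S u - u - w‖ ≤ t * m₁ := by
      have e : (Φ t (x', S u)).1 - (Φ t (x, u)).1 - (x' - x) - t • (S u - u) =
          -(t • (S u - u - w)) := by
        rw [hpos, hw]; module
      rw [e, norm_neg, norm_smul, Real.norm_of_nonneg ht0.le, sq, mul_assoc] at hx
      exact le_of_mul_le_mul_left hx ht0
    have hm₁m : m₁ ≤ m := by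
      have h1 : ‖S u - u‖ ≤ t * m₁ + ‖w‖ := by
        have := norm_add_le (S u - u - w) w
        rw [sub_add_cancel] at this
        linarith
      have h2 : t * ‖S u - u‖ ≤ t * (t * m₁ + ‖w‖) := by gcongr
      have h3 : t * (t * m₁) ≤ 1 / 64 * m₁ := by
        rw [← mul_assoc]; gcongr; nlinarith
      linarith
    have hLH := h.nonneg
    obtain ⟨Y, W, hY⟩ := h.exists_isJacobi ht0.le ht (x, u)
    obtain ⟨Y', W', hY'⟩ := h.exists_isJacobi ht0.le ht (x', S u)
    have hYd := h.hasFDerivAt_position ht0.le ht hY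
    have hYd' := h.hasFDerivAt_position ht0.le ht hY'
    have hfrob := h.frobNorm_jacobi_sub_le ht0.le ht hY hY' (m := m₁) fun s hs' => (hs s hs').1
    have hone : ∀ {Z : Ed d →L[ℝ] Ed d}, ‖Z - t • 1‖ ≤ t / 63 → ‖t⁻¹ • Z - 1‖ ≤ 1 / 63 :=
      fun {Z} hZ => by
        have e : t⁻¹ • Z - 1 = t⁻¹ • (Z - t • 1) := by
          rw [smul_sub, inv_smul_smul₀ ht0.ne']
        rw [e, norm_smul, norm_inv, Real.norm_of_nonneg ht0.le, inv_mul_le_iff₀ ht0]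
        linarith
    have hZ := hone (h.isJacobi_bounds ht0.le ht hY).2
    have hZ' := hone (h.isJacobi_bounds ht0.le ht hY').2
    obtain ⟨e, he, hes⟩ := exists_continuousLinearEquiv_of_norm_sub_one_le hZ'
    have hPd : HasFDerivAt (fun u => P u + t⁻¹ • δ') (t⁻¹ • Y t) u := by
      refine ((hYd.const_smul t⁻¹).add_const (t⁻¹ • δ')).congr_of_eventuallyEq
        (Filter.Eventually.of_forall fun v => ?_)
      simp [hP]
    have hPd' : HasFDerivAt P' (e : Ed d →L[ℝ] Ed d) (S u) := by
      rw [he]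
      refine (hYd'.const_smul t⁻¹).congr_of_eventuallyEq (Filter.Eventually.of_forall fun v => ?_)
      simp [hP']
    have hinv : HasFDerivAt P'.symm (e.symm : Ed d →L[ℝ] Ed d) (P u + t⁻¹ • δ') :=
      HasFDerivAt.of_local_left_inverse P'.symm.continuous.continuousAt hPd'
        (Filter.Eventually.of_forall P'.apply_symm_apply)
    have hSd := hinv.comp u hPd
    have hsplit : (e.symm : Ed d →L[ℝ] Ed d) ∘L (t⁻¹ • Y t) =
        1 + (e.symm : Ed d →L[ℝ] Ed d) ∘L (t⁻¹ • Y t - t⁻¹ • Y' t) := by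
      rw [← he, ContinuousLinearMap.comp_sub]
      ext v
      simp
    rw [hsplit] at hSd
    refine ⟨_, hSd, ?_, ?_, hSw.trans (by gcongr), ?_⟩
    · refine (ContinuousLinearMap.opNorm_comp_le _ _).trans ?_
      have h1 : ‖t⁻¹ • Y t - t⁻¹ • Y' t‖ ≤ 2 / 63 := by
        have := norm_sub_le (t⁻¹ • Y t - 1) (t⁻¹ • Y' t - 1)
        rw [sub_sub_sub_cancel_right] at this
        linarith
      calc _ ≤ 63 / 62 * (2 / 63 : ℝ) := by gcongr
        _ ≤ 1 / 4 := by norm_num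
    · refine (frobNorm_comp_le_opNorm_mul _ _).trans ?_
      have h1 : frobNorm (t⁻¹ • Y t - t⁻¹ • Y' t) ≤ 1.04 * t ^ 2 * LH * m := by
        rw [(smul_sub t⁻¹ (Y t) (Y' t)).symm, ← norm_columnsCLM, map_smul, norm_smul,
          norm_columnsCLM, norm_inv,
          Real.norm_of_nonneg ht0.le, inv_mul_le_iff₀ ht0]
        calc _ ≤ 1.04 * t ^ 3 * LH * m₁ := hfrob
          _ ≤ 1.04 * t ^ 3 * LH * m := by gcongr
          _ = _ := by ring
      have h2 : 0 ≤ t ^ 2 * LH * m := by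
        have : 0 ≤ m := hm0.trans hm₁m
        positivity
      have h3 : 63 / 62 * frobNorm (t⁻¹ • Y t - t⁻¹ • Y' t) ≤
          63 / 62 * (1.04 * t ^ 2 * LH * m) := by gcongr
      have h4 := mul_le_mul_of_nonneg_right hes (frobNorm_nonneg (t⁻¹ • Y t - t⁻¹ • Y' t))
      linarith
    · have := norm_add_le ((Φ t (x', S u)).2 - (Φ t (x, u)).2 - (S u - u)) (S u - u - w)
      rw [sub_add_sub_cancel] at this
      have h1 : t * m₁ ≤ t * m := by gcongr
      linarith
  choose A hA using hJ
  exact ⟨S, A, hinj, fun u => ⟨hpos u, hA u⟩⟩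

end IsNewtonFlow
end NewtonFlow

section ProductShift

/-- Entropic cost of a triangular shift of a product measure. -/
lemma EntropyDualLE.prod {α β : Type*} [MeasurableSpace α] [MeasurableSpace β]
    {N : Measure α} {N' : Measure β} [IsProbabilityMeasure N] [IsProbabilityMeasure N']
    {T : α → α} {R : α × β → β} (hT : Measurable T) (hR : Measurable R) {c c' : ℝ}
    (h : EntropyDualLE (N.map T) N c)
    (h' : ∀ g, EntropyDualLE (N'.map fun g' => R (g, g')) N' c') :
    EntropyDualLE ((N.prod N').map fun p => (T p.1, R p)) (N.prod N') (c + c') := by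
  rintro f hf ⟨M, hM⟩
  have hTR : Measurable fun p : α × β => (T p.1, R p) := (hT.comp measurable_fst).prodMk hR
  rw [integral_map hTR.aemeasurable hf.aestronglyMeasurable,
    integral_prod (fun p : α × β => f (T p.1, R p))
      (integrable_of_abs_le (hf.comp hTR) fun p => hM _),
    integral_prod _ (integrable_exp_of_abs_le hf hM)]
  have hsec : ∀ g, Measurable fun g' => f (g, g') := fun g => hf.comp measurable_prodMk_left
  let φ : α → ℝ := fun g => log (∫ g', exp (f (g, g')) ∂N')
  have hφm : Measurable φ := hf.exp.stronglyMeasurable.integral_prod_right.measurable.log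
  have hφM : ∀ g, |φ g| ≤ M := fun g => abs_log_integral_exp_le (hsec g) fun g' => hM _
  have h1 := h φ hφm ⟨M, hφM⟩
  rw [integral_map hT.aemeasurable hφm.aestronglyMeasurable] at h1
  have h2 : ∀ g, exp (φ g) = ∫ g', exp (f (g, g')) ∂N' := fun g =>
    exp_log (integral_exp_pos (integrable_exp_of_abs_le (hsec g) fun g' => hM _))
  simp only [h2] at h1
  have hφT : Integrable (fun g => φ (T g)) N :=
    integrable_of_abs_le (hφm.comp hT) fun g => hφM _
  have h3 : ∫ g, ∫ g', f (T g, R (g, g')) ∂N' ∂N ≤ ∫ g, (φ (T g) + c') ∂N := by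
    refine integral_mono ?_ (hφT.add (integrable_const _)) fun g => ?_
    · have hF : Measurable (Function.uncurry fun g g' => f (T g, R (g, g'))) := hf.comp hTR
      exact integrable_of_abs_le hF.stronglyMeasurable.integral_prod_right.measurable
        fun g => abs_integral_le_of_abs_le fun g' => hM (T g, R (g, g'))
    · have := h' g (fun g' => f (T g, g')) (hsec _) ⟨M, fun g' => hM _⟩
      have hRg : Measurable fun g' => R (g, g') := hR.comp measurable_prodMk_left
      rwa [integral_map hRg.aemeasurable (hsec _).aestronglyMeasurable] at this
  rw [integral_add hφT (integrable_const _)] at h3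
  simp only [integral_const, probReal_univ, smul_eq_mul, one_mul] at h3
  linarith

end ProductShift

section Kernel

open ProbabilityTheory

variable {d : ℕ} {Φ : ℝ → Phase d → Phase d} {t : ℝ}

/-- One transition of `Q = D_η H_t D_η` as a function of the driving noise. -/
noncomputable def transitionQ (Φ : ℝ → Phase d → Phase d) (t η : ℝ) (z : Phase d)
    (gg : Ed d × Ed d) : Phase d :=
  ((Φ t (z.1, η • z.2 + Real.sqrt (1 - η ^ 2) • gg.1)).1,
    η • (Φ t (z.1, η • z.2 + Real.sqrt (1 - η ^ 2) • gg.1)).2 + Real.sqrt (1 - η ^ 2) • gg.2)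

lemma measurable_transitionQ_uncurry (hΦ : Continuous (Φ t)) (η : ℝ) :
    Measurable fun p : Phase d × Ed d × Ed d => transitionQ Φ t η p.1 p.2 := by
  unfold transitionQ
  fun_prop

lemma measurable_transitionQ (hΦ : Continuous (Φ t)) (η : ℝ) (z : Phase d) :
    Measurable (transitionQ Φ t η z) :=
  (measurable_transitionQ_uncurry hΦ η).comp measurable_prodMk_left

/-- The transition kernel of `Q`. -/
noncomputable def kernelQ (hΦ : Continuous (Φ t)) (η : ℝ) : Kernel (Phase d) (Phase d) where
  toFun z := ((stdGaussian d).prod (stdGaussian d)).map (transitionQ Φ t η z)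
  measurable' := by
    have h := (Kernel.id ×ₖ Kernel.const (Phase d) ((stdGaussian d).prod (stdGaussian d))).map
      (fun p : Phase d × Ed d × Ed d => transitionQ Φ t η p.1 p.2) |>.measurable
    convert h using 2 with z
    rw [Kernel.map_apply _ (measurable_transitionQ_uncurry hΦ η), Kernel.prod_apply,
      Kernel.id_apply, Kernel.const_apply, Measure.dirac_prod,
      Measure.map_map (measurable_transitionQ_uncurry hΦ η) measurable_prodMk_left]
    rfl

instance (hΦ : Continuous (Φ t)) (η : ℝ) : IsMarkovKernel (kernelQ hΦ η) :=
  ⟨fun z => Measure.isProbabilityMeasure_map (measurable_transitionQ hΦ η z).aemeasurable⟩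

/-- The `n`-step transition kernel of `Q`. -/
noncomputable def kernelQIter (hΦ : Continuous (Φ t)) (η : ℝ) :
    ℕ → Kernel (Phase d) (Phase d)
  | 0 => Kernel.id
  | n + 1 => kernelQIter hΦ η n ∘ₖ kernelQ hΦ η

instance (hΦ : Continuous (Φ t)) (η : ℝ) (n : ℕ) : IsMarkovKernel (kernelQIter hΦ η n) := by
  induction n with
  | zero => exact inferInstanceAs (IsMarkovKernel Kernel.id)
  | succ n ih => exact inferInstanceAs (IsMarkovKernel (kernelQIter hΦ η n ∘ₖ kernelQ hΦ η))

lemma stepQ_iterate (hΦ : Continuous (Φ t)) (η : ℝ) (n : ℕ) (ν : Measure (Phase d)) :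
    (stepQ Φ t η)^[n] ν = ν.bind (kernelQIter hΦ η n) := by
  induction n generalizing ν with
  | zero => exact (Measure.bind_dirac (m := ν)).symm
  | succ n ih =>
    rw [Function.iterate_succ_apply, ih]
    have h : stepQ Φ t η ν = ν.bind (kernelQ hΦ η) := rfl
    rw [h, Measure.bind_bind (kernelQ hΦ η).aemeasurable (kernelQIter hΦ η n).aemeasurable]
    rfl

lemma kernelQIter_succ_apply (hΦ : Continuous (Φ t)) (η : ℝ) (n : ℕ) (z : Phase d) :
    kernelQIter hΦ η (n + 1) z = ((stdGaussian d).prod (stdGaussian d)).bind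
      ((kernelQIter hΦ η n).comap (transitionQ Φ t η z) (measurable_transitionQ hΦ η z)) := by
  have h : kernelQIter hΦ η (n + 1) z = (kernelQ hΦ η z).bind (kernelQIter hΦ η n) :=
    Kernel.comp_apply _ _ _
  rw [h]
  ext A hA
  rw [Measure.bind_apply hA (Kernel.aemeasurable _), Measure.bind_apply hA (Kernel.aemeasurable _)]
  change ∫⁻ a, kernelQIter hΦ η n a A ∂(Measure.map _ _) = _
  rw [lintegral_map (Kernel.measurable_coe _ hA) (measurable_transitionQ hΦ η z)]
  rfl

lemma stepQ_iterate_dirac (hΦ : Continuous (Φ t)) (η : ℝ) (n : ℕ) (z : Phase d) :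
    (stepQ Φ t η)^[n] (Measure.dirac z) = kernelQIter hΦ η n z := by
  rw [stepQ_iterate hΦ, Measure.dirac_bind (Kernel.measurable _)]

/-- If the noise of the second chain is shifted so that the next states satisfy a bound
uniformly, then the entropic costs add up. -/
lemma entropyDualLE_kernelQIter_succ (hΦ : Continuous (Φ t)) (η : ℝ) (n : ℕ) {z z' : Phase d}
    {T : Ed d × Ed d → Ed d × Ed d} (hT : Measurable T) {c C : ℝ}
    (hcT : EntropyDualLE (((stdGaussian d).prod (stdGaussian d)).map T)
      ((stdGaussian d).prod (stdGaussian d)) c)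
    (h : ∀ gg, EntropyDualLE (kernelQIter hΦ η n (transitionQ Φ t η z gg))
      (kernelQIter hΦ η n (transitionQ Φ t η z' (T gg))) C) :
    EntropyDualLE (kernelQIter hΦ η (n + 1) z) (kernelQIter hΦ η (n + 1) z') (c + C) := by
  rw [kernelQIter_succ_apply, kernelQIter_succ_apply]
  exact EntropyDualLE.bind hT hcT h

end Kernel

section Path

variable {E : Type*} [NormedAddCommGroup E] [NormedSpace ℝ E]

/-- Discrete quadratic steering path: velocities `v k` that bring the displacement `δ` from `a` to
`0` in `N` steps of length `t`, starting near `b` and ending near `0`. -/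
lemma exists_steering_path (a b : E) {N : ℕ} (hN : 1 ≤ N) {t M : ℝ} (ht : 0 < t)
    (hM : M = ‖a‖ + t * N * ‖b‖) :
    ∃ v δ : ℕ → E, δ 0 = a ∧ δ N = 0 ∧ v N = 0 ∧ (∀ k < N, δ (k + 1) = δ k + t • v k) ∧
      (∀ k ≤ N, ‖v k‖ ≤ 7 / 4 * M / (t * N)) ∧ ‖v 0 - b‖ ≤ 6 * M * t / (t * N) ^ 2 ∧
      (∀ k < N, ‖v (k + 1) - v k‖ ≤ 6 * M * t / (t * N) ^ 2) ∧
      ∀ k ≤ N, ‖δ k‖ ≤ 7 / 4 * M := by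
  have hN1 : (1 : ℝ) ≤ N := by exact_mod_cast hN
  have hs : 0 < t * N := by positivity
  obtain ⟨κ, hκ⟩ : ∃ κ : ℝ, κ = 6 / (t * N * (N + 1) * (N + 2)) := ⟨_, rfl⟩
  have hκ0 : 0 ≤ κ := by rw [hκ]; positivity
  have hκe : κ * (t * N * (N + 1) * (N + 2)) = 6 := by rw [hκ]; field_simp
  obtain ⟨e, he⟩ : ∃ e : E, e = κ • (a + (t * N / 2) • b) := ⟨_, rfl⟩
  have hen : ‖e‖ ≤ κ * (‖a‖ + t * N / 2 * ‖b‖) := by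
    rw [he, norm_smul, Real.norm_of_nonneg hκ0]
    gcongr
    refine (norm_add_le _ _).trans ?_
    rw [norm_smul, Real.norm_of_nonneg (by positivity)]
  let v : ℕ → E := fun k => (((N : ℝ) - k) / (N + 1)) • b - (((k : ℝ) + 1) * (N - k)) • e
  have hv : ∀ k, v k = (((N : ℝ) - k) / (N + 1)) • b - (((k : ℝ) + 1) * (N - k)) • e := fun k => rfl
  have hvk : ∀ k ≤ N, ‖v k‖ ≤ 7 / 4 * M / (t * N) := by
    intro k hk
    have hk' : (k : ℝ) ≤ N := by exact_mod_cast hk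
    have hk0 : (0 : ℝ) ≤ k := by positivity
    have h1 : ((N : ℝ) - k) / (N + 1) ≤ 1 := by rw [div_le_one (by positivity)]; linarith
    have h2 : ((k : ℝ) + 1) * (N - k) ≤ (N + 1) * (N + 2) / 4 := by
      nlinarith [sq_nonneg ((k : ℝ) + 1 - (N - k))]
    have h3 : ‖v k‖ ≤ ‖b‖ + (N + 1) * (N + 2) / 4 * ‖e‖ := by
      rw [hv]
      refine (norm_sub_le _ _).trans ?_
      rw [norm_smul, norm_smul, Real.norm_of_nonneg (div_nonneg (by linarith) (by positivity)),
        Real.norm_of_nonneg (mul_nonneg (by linarith) (by linarith))]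
      exact add_le_add (mul_le_of_le_one_left (norm_nonneg _) h1) (by gcongr)
    rw [le_div_iff₀ hs]
    calc ‖v k‖ * (t * N)
        ≤ (‖b‖ + (N + 1) * (N + 2) / 4 * (κ * (‖a‖ + t * N / 2 * ‖b‖))) * (t * N) := by
          gcongr
          exact h3.trans (by gcongr)
      _ = t * N * ‖b‖ + κ * (t * N * (N + 1) * (N + 2)) / 4 * (‖a‖ + t * N / 2 * ‖b‖) := by ring
      _ ≤ 7 / 4 * M := by rw [hκe, hM]; linarith [norm_nonneg a]
  have hinc : ∀ c : ℝ, |c| ≤ N → ∀ y : E, y = -((1 / ((N : ℝ) + 1)) • b) - c • e →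
      ‖y‖ ≤ 6 * M * t / (t * N) ^ 2 := by
    intro c hc y hy
    have h3 : ‖y‖ ≤ 1 / ((N : ℝ) + 1) * ‖b‖ + N * ‖e‖ := by
      rw [hy]
      refine (norm_sub_le _ _).trans ?_
      rw [norm_neg, norm_smul, norm_smul, Real.norm_of_nonneg (by positivity)]
      gcongr
      simpa using hc
    have h4 : 1 / ((N : ℝ) + 1) * N ≤ 1 := by
      rw [one_div_mul_eq_div, div_le_one (by positivity)]; linarith
    have h5 : κ * (t * N ^ 3) ≤ 6 := by
      rw [← hκe]
      gcongr κ * ?_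
      have : (0 : ℝ) ≤ t * N := hs.le
      nlinarith
    have h6 : 6 * M * t / (t * N) ^ 2 = 6 * M / (t * N ^ 2) := by field_simp
    rw [h6, le_div_iff₀ (by positivity)]
    calc ‖y‖ * (t * N ^ 2)
        ≤ (1 / ((N : ℝ) + 1) * ‖b‖ + N * (κ * (‖a‖ + t * N / 2 * ‖b‖))) * (t * N ^ 2) := by
          gcongr
          exact h3.trans (by gcongr)
      _ = 1 / ((N : ℝ) + 1) * N * (t * N * ‖b‖) + κ * (t * N ^ 3) * (‖a‖ + t * N / 2 * ‖b‖) := by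
          ring
      _ ≤ 1 * (t * N * ‖b‖) + 6 * (‖a‖ + t * N / 2 * ‖b‖) := by gcongr
      _ ≤ 6 * M := by
          rw [hM]
          have : 0 ≤ t * N * ‖b‖ := by positivity
          linarith
  have hsum1 : ∀ n : ℕ, ∑ k ∈ Finset.range n, ((N : ℝ) - k) = n * N - n * (n - 1) / 2 := by
    intro n
    induction n with
    | zero => simp
    | succ n ih => rw [Finset.sum_range_succ, ih]; push_cast; ring
  have hsum2 : ∀ n : ℕ, ∑ k ∈ Finset.range n, (((k : ℝ) + 1) * (N - k)) =
      n * (n + 1) / 2 * N - (n - 1) * n * (n + 1) / 3 := by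
    intro n
    induction n with
    | zero => simp
    | succ n ih => rw [Finset.sum_range_succ, ih]; push_cast; ring
  have hsum : t • ∑ k ∈ Finset.range N, v k = -a := by
    simp only [hv]
    rw [Finset.sum_sub_distrib, ← Finset.sum_smul, ← Finset.sum_smul, ← Finset.sum_div, hsum1,
      hsum2, he, smul_smul, smul_sub, smul_smul, smul_smul]
    have e1 : t * (((N : ℝ) * (N + 1) / 2 * N - (N - 1) * N * (N + 1) / 3) * κ) = 1 := by
      have : t * (((N : ℝ) * (N + 1) / 2 * N - (N - 1) * N * (N + 1) / 3) * κ) =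
        κ * (t * N * (N + 1) * (N + 2)) / 6 := by ring
      rw [this, hκe]; norm_num
    have e2 : t * (((N : ℝ) * N - N * (N - 1) / 2) / (N + 1)) = t * N / 2 := by
      field_simp; ring
    rw [e1, e2, one_smul]
    abel
  refine ⟨v, fun k => -(t • ∑ j ∈ Finset.Ico k N, v j), ?_, by simp, ?_, ?_, hvk, ?_, ?_, ?_⟩
  · simp [hsum]
  · simp [hv]
  · intro k hk
    simp only
    rw [Finset.sum_eq_sum_Ico_succ_bot hk, smul_add]
    abel
  · refine hinc N (by simp) _ ?_
    rw [hv]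
    have e1 : ((N : ℝ) - (0 : ℕ)) / (N + 1) = 1 - 1 / (N + 1) := by
      field_simp; push_cast; ring
    rw [e1]
    push_cast
    module
  · intro k hk
    have hk' : (k : ℝ) + 1 ≤ N := by exact_mod_cast hk
    have hk0 : (0 : ℝ) ≤ k := by positivity
    refine hinc (N - 2 * (k + 1)) (abs_le.2 ⟨by linarith, by linarith⟩) _ ?_
    rw [hv, hv]
    have e1 : ((N : ℝ) - (k + 1 : ℕ)) / (N + 1) = (N - k) / (N + 1) - 1 / (N + 1) := by
      field_simp; push_cast; ring
    rw [e1]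
    push_cast
    module
  · intro k hk
    simp only [norm_neg]
    rw [norm_smul, Real.norm_of_nonneg ht.le]
    have hM0 : 0 ≤ M := by rw [hM]; positivity
    have h1 : ‖∑ j ∈ Finset.Ico k N, v j‖ ≤ (N - k : ℕ) * (7 / 4 * M / (t * N)) := by
      refine (norm_sum_le _ _).trans ?_
      refine (Finset.sum_le_card_nsmul _ _ _ fun j hj =>
        hvk j (Finset.mem_Ico.1 hj).2.le).trans_eq ?_
      rw [Nat.card_Ico, nsmul_eq_mul]
    have h2 : ((N - k : ℕ) : ℝ) ≤ N := by exact_mod_cast Nat.sub_le _ _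
    calc t * ‖∑ j ∈ Finset.Ico k N, v j‖ ≤ t * (N * (7 / 4 * M / (t * N))) := by
          gcongr
          exact h1.trans (by gcongr)
      _ = 7 / 4 * M := by field_simp

end Path

section Chain

variable {d : ℕ} {F : Ed d → Ed d} {LH t η : ℝ} {Φ : ℝ → Phase d → Phase d}

/-- Shift of the velocity noise of the second chain under which the displacement after one
transition is prescribed in position and controlled in velocity. -/
lemma IsNewtonFlow.exists_noise_shift (h : IsNewtonFlow F LH Φ) (ht0 : 0 < t) (ht : t ≤ 1 / 8)
    {σ : ℝ} (hσ : 0 < σ) (x v x' v' δ' w : Ed d) (hw : δ' = x' - x + t • w) {m ρ : ℝ}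
    (hm : 32 / 31 * (‖x' - x‖ + t * ‖w‖) ≤ m) (hρ : ‖w - η • (v' - v)‖ ≤ ρ) :
    ∃ T q : Ed d → Ed d, Measurable T ∧ Measurable q ∧
      EntropyDualLE ((stdGaussian d).map T) (stdGaussian d)
        (((ρ + t * m) / σ) ^ 2 / 2 + 4 * (2 * t ^ 2 * LH * m) ^ 2) ∧
      ∀ g, Φ t (x', η • v' + σ • T g) = Φ t (x, η • v + σ • g) + (δ', q g) ∧
        ‖q g - w‖ ≤ 2 * t * m := by
  obtain ⟨S, A, hSinj, hS⟩ := h.exists_coupling ht0 ht x x' δ' w hw hm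
  have hSc : Continuous S := continuous_iff_continuousAt.2 fun u => (hS u).2.1.continuousAt
  have hΦc : Continuous (Φ t) := (h.lipschitzWith ht0.le ht).continuous
  let T : Ed d → Ed d := fun g => σ⁻¹ • (S (η • v + σ • g) - η • v')
  have hTdef : ∀ g, T g = σ⁻¹ • (S (η • v + σ • g) - η • v') := fun g => rfl
  have hST : ∀ g, η • v' + σ • T g = S (η • v + σ • g) := fun g => by
    rw [hTdef, smul_inv_smul₀ hσ.ne', add_sub_cancel]
  refine ⟨T, fun g => (Φ t (x', S (η • v + σ • g))).2 - (Φ t (x, η • v + σ • g)).2, ?_, ?_, ?_, ?_⟩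
  · exact Continuous.measurable (by fun_prop)
  · exact Continuous.measurable (by fun_prop)
  · refine entropyDualLE_map_stdGaussian (A := fun g => A (η • v + σ • g)) ?_ ?_ ?_ ?_ ?_
    · intro g g' hgg
      have h1 : S (η • v + σ • g) = S (η • v + σ • g') := by rw [← hST, ← hST, hgg]
      exact smul_right_injective _ hσ.ne' (add_left_cancel (hSinj h1))
    · intro g
      have h1 : HasFDerivAt (fun g : Ed d => η • v + σ • g) (σ • (1 : Ed d →L[ℝ] Ed d)) g :=
        ((hasFDerivAt_id g).const_smul σ).const_add _
      have h2 := (((hS (η • v + σ • g)).2.1.comp g h1).sub_const (η • v')).const_smul σ⁻¹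
      refine HasFDerivAt.congr_fderiv (f := T) h2 ?_
      ext1 y
      simp [smul_smul, inv_mul_cancel₀ hσ.ne']
    · intro g
      have h1 : T g - g = σ⁻¹ •
          ((S (η • v + σ • g) - (η • v + σ • g) - w) + (w - η • (v' - v))) := by
        have : g = σ⁻¹ • (σ • g) := (inv_smul_smul₀ hσ.ne' g).symm
        rw [hTdef]
        nth_rewrite 2 [this]
        rw [← smul_sub]
        congr 1
        module
      rw [h1, norm_smul, Real.norm_of_nonneg (by positivity), inv_mul_eq_div]
      gcongr
      refine (norm_add_le _ _).trans ?_
      linarith [(hS (η • v + σ • g)).2.2.2.2.1]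
    · exact fun g => (hS _).2.2.1
    · exact fun g => (hS _).2.2.2.1
  · intro g
    refine ⟨?_, (hS _).2.2.2.2.2⟩
    rw [hST]
    refine Prod.ext (hS _).1 ?_
    simp

/-- Chained entropic cost of steering the second chain onto the first one along a given path. -/
lemma IsNewtonFlow.entropyDualLE_of_path (h : IsNewtonFlow F LH Φ) (ht0 : 0 < t) (ht : t ≤ 1 / 8)
    (hη0 : 0 ≤ η) (hη1 : η < 1) {N : ℕ} {w δ : ℕ → Ed d} {m ρ ε B : ℝ} (hδN : δ N = 0)
    (hwN : w N = 0) (hδ : ∀ k < N, δ (k + 1) = δ k + t • w k)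
    (hm : ∀ k < N, 32 / 31 * (‖δ k‖ + t * ‖w k‖) ≤ m) (hB : ∀ k < N, ‖w k‖ ≤ B)
    (hε : ∀ k < N, ‖w (k + 1) - w k‖ ≤ ε) (hρ : ε + (1 - η ^ 2) * B + 2 * t * m ≤ ρ)
    (l : ℕ) (j : ℕ) : ∀ k, k + j + 1 = N → ∀ x v x' v' : Ed d, x' - x = δ k →
      ‖w k - η • (v' - v)‖ ≤ ρ →
      EntropyDualLE
        (kernelQIter (h.lipschitzWith ht0.le ht).continuous η (j + 1 + l) (x, v))
        (kernelQIter (h.lipschitzWith ht0.le ht).continuous η (j + 1 + l) (x', v'))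
        ((j + 1) * (((ρ + t * m) / √(1 - η ^ 2)) ^ 2 / 2 + 4 * (2 * t ^ 2 * LH * m) ^ 2) +
          (ρ / √(1 - η ^ 2)) ^ 2 / 2) := by
  have hσ2 : 0 < 1 - η ^ 2 := by nlinarith
  have hσ : 0 < √(1 - η ^ 2) := Real.sqrt_pos.2 hσ2
  have hq_le : ∀ k < N, ∀ q : Ed d, ‖q - w k‖ ≤ 2 * t * m → ∀ c : ℝ, η ^ 2 ≤ c → c ≤ 1 →
      ‖w (k + 1) - c • q‖ ≤ ρ := by
    intro k hk q hq c hc hc1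
    have hc0 : 0 ≤ c := (sq_nonneg η).trans hc
    have h1 : w (k + 1) - c • q = (w (k + 1) - w k) + (1 - c) • w k - c • (q - w k) := by module
    have h2 : ‖(1 - c) • w k‖ ≤ (1 - η ^ 2) * B := by
      rw [norm_smul, Real.norm_of_nonneg (by linarith)]
      exact mul_le_mul (by linarith) (hB k hk) (norm_nonneg _) hσ2.le
    have h3 : ‖c • (q - w k)‖ ≤ 2 * t * m := by
      rw [norm_smul, Real.norm_of_nonneg hc0]
      exact (mul_le_of_le_one_left (norm_nonneg _) hc1).trans hq
    rw [h1]
    linarith [norm_sub_le ((w (k + 1) - w k) + (1 - c) • w k) (c • (q - w k)),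
      norm_add_le (w (k + 1) - w k) ((1 - c) • w k), hε k hk]
  induction j with
  | zero =>
    intro k hk x v x' v' hx hv
    have hkN : k < N := by omega
    obtain ⟨T, q, hT, hq, hcost, hstep⟩ := h.exists_noise_shift ht0 ht hσ x v x' v' (δ (k + 1))
      (w k) (m := m) (by rw [hδ k hkN, hx]) (by rw [hx]; exact hm k hkN) hv
    have hkN1 : k + 1 = N := by omega
    let c : Ed d → Ed d := fun g => -((√(1 - η ^ 2))⁻¹ • η • q g)
    have hR : Measurable fun p : Ed d × Ed d => p.2 + c p.1 := by fun_prop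
    have hlast := EntropyDualLE.prod hT hR hcost (N' := stdGaussian d)
      (c' := (ρ / √(1 - η ^ 2)) ^ 2 / 2) fun g =>
        (entropyDualLE_map_add_const (c g)).mono <| by
          have h1 : ‖c g‖ ≤ ρ / √(1 - η ^ 2) := by
            have h2 := hq_le k hkN (q g) (hstep g).2 η (by nlinarith) hη1.le
            rw [hkN1, hwN, zero_sub, norm_neg] at h2
            rw [norm_neg, norm_smul, Real.norm_of_nonneg (by positivity), inv_mul_eq_div]
            gcongr
          gcongr
    have hmeas : Measurable fun p : Ed d × Ed d => (T p.1, p.2 + c p.1) :=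
      (hT.comp measurable_fst).prodMk hR
    have hchain := entropyDualLE_kernelQIter_succ (h.lipschitzWith ht0.le ht).continuous η l
      (z := (x, v)) (z' := (x', v')) hmeas hlast (C := 0) fun gg => by
        have heq : transitionQ Φ t η (x', v') (T gg.1, gg.2 + c gg.1) =
            transitionQ Φ t η (x, v) gg := by
          simp only [transitionQ, (hstep gg.1).1, hkN1, hδN]
          refine Prod.ext (by simp) ?_
          simp only [c, Prod.snd_add, smul_add, smul_neg, smul_inv_smul₀ hσ.ne']
          abel
        rw [heq]
        exact EntropyDualLE.refl _
    rw [show 0 + 1 + l = l + 1 by omega]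
    refine hchain.mono (le_of_eq ?_)
    push_cast
    ring
  | succ j ih =>
    intro k hk x v x' v' hx hv
    have hkN : k < N := by omega
    obtain ⟨T, q, hT, hq, hcost, hstep⟩ := h.exists_noise_shift ht0 ht hσ x v x' v' (δ (k + 1))
      (w k) (m := m) (by rw [hδ k hkN, hx]) (by rw [hx]; exact hm k hkN) hv
    have hprod := EntropyDualLE.prod hT measurable_snd hcost (N' := stdGaussian d) (c' := 0)
      fun g => by
        simpa using EntropyDualLE.refl (stdGaussian d)
    have hmeas : Measurable fun p : Ed d × Ed d => (T p.1, p.2) :=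
      (hT.comp measurable_fst).prodMk measurable_snd
    have hchain := entropyDualLE_kernelQIter_succ (h.lipschitzWith ht0.le ht).continuous η
      (j + 1 + l) (z := (x, v)) (z' := (x', v')) hmeas hprod fun gg => by
        refine ih (k + 1) (by omega) _ _ _ _ ?_ ?_
        · simp [(hstep gg.1).1]
        · have h2 := hq_le k hkN (q gg.1) (hstep gg.1).2 (η ^ 2) le_rfl (by nlinarith)
          convert h2 using 3
          simp only [(hstep gg.1).1, Prod.snd_add]
          module
    rw [show j + 1 + 1 + l = j + 1 + l + 1 by omega]
    refine hchain.mono (le_of_eq ?_)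
    push_cast
    ring

end Chain

section Bound

/-- Explicit bound for the total cost of the steering strategy. -/
lemma steering_cost_le {N t s γ η σ LH A B M : ℝ} (hN : 2 ≤ N) (ht : 0 < t) (ht8 : t ≤ 1 / 8)
    (hs : s = t * N) (hs4 : s ≤ 1 / 4) (hγ : 0 < γ) (hη0 : 0 < η) (hη1 : η ≤ 1) (hσ : 0 < σ)
    (hσγ : γ * t ≤ σ ^ 2) (hA : 0 ≤ A) (hB : 0 ≤ B) (hM : M = A + B) :
    N * (((t * (M * (6 / s ^ 2 + 7 / 2 * γ / s + 11 / 2)) + t * (11 / 4 * M)) / σ) ^ 2 / 2 +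
        4 * (2 * t ^ 2 * LH * (11 / 4 * M)) ^ 2) +
      (t * (M * (6 / s ^ 2 + 7 / 2 * γ / s + 11 / 2)) / σ) ^ 2 / 2 ≤
    (s / γ * (12 / (η * s ^ 2) + 6 * γ / (η * s) + 4) ^ 2 + 132 * (LH * s) ^ 2) *
      (A ^ 2 + B ^ 2) := by
  have hs0 : 0 < s := by rw [hs]; positivity
  have hM0 : 0 ≤ M := by rw [hM]; positivity
  have hM2 : M ^ 2 ≤ 2 * (A ^ 2 + B ^ 2) := by rw [hM]; nlinarith [sq_nonneg (A - B)]
  have hinv : 16 ≤ 1 / s ^ 2 := by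
    rw [le_div_iff₀ (by positivity)]; nlinarith
  obtain ⟨R, hR⟩ : ∃ R, R = 6 / s ^ 2 + 7 / 2 * γ / s + 33 / 4 := ⟨_, rfl⟩
  obtain ⟨K, hK⟩ : ∃ K, K = 12 / (η * s ^ 2) + 6 * γ / (η * s) + 4 := ⟨_, rfl⟩
  have hR0 : 0 ≤ R := by rw [hR]; positivity
  have hRK : 5 / 4 * R ≤ K := by
    have h1 : 12 / s ^ 2 ≤ 12 / (η * s ^ 2) := by
      gcongr; exact mul_le_of_le_one_left (by positivity) hη1
    have h2 : 6 * γ / s ≤ 6 * γ / (η * s) := by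
      gcongr; exact mul_le_of_le_one_left (by positivity) hη1
    have h3 : 0 ≤ γ / s := by positivity
    have e1 : 12 / s ^ 2 = 12 * (1 / s ^ 2) := by ring
    have e2 : 6 / s ^ 2 = 6 * (1 / s ^ 2) := by ring
    have e3 : 6 * γ / s = 6 * (γ / s) := by ring
    have e4 : 7 / 2 * γ / s = 7 / 2 * (γ / s) := by ring
    rw [hR, hK]
    linarith
  have hshift : (t * (M * R) / σ) ^ 2 ≤ t / γ * (M * R) ^ 2 := by
    rw [div_pow, div_le_iff₀ (by positivity)]
    calc (t * (M * R)) ^ 2 = t / γ * (M * R) ^ 2 * (γ * t) := by field_simp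
      _ ≤ _ := by gcongr
  have h1 : (t * (M * (6 / s ^ 2 + 7 / 2 * γ / s + 11 / 2)) + t * (11 / 4 * M)) =
      t * (M * R) := by rw [hR]; ring
  have h2 : (t * (M * (6 / s ^ 2 + 7 / 2 * γ / s + 11 / 2)) / σ) ^ 2 ≤ (t * (M * R) / σ) ^ 2 := by
    
    rw [hR]; gcongr (t * (M * (_ + ?_)) / σ) ^ 2; norm_num
  rw [h1, ← hK]
  have h3 : N * ((t * (M * R) / σ) ^ 2 / 2) + (t * (M * R) / σ) ^ 2 / 2 ≤
      s / γ * K ^ 2 * (A ^ 2 + B ^ 2) := by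
    calc N * ((t * (M * R) / σ) ^ 2 / 2) + (t * (M * R) / σ) ^ 2 / 2
        = (N + 1) / 2 * (t * (M * R) / σ) ^ 2 := by ring
      _ ≤ (3 / 4 * N) * (t / γ * (M * R) ^ 2) := by gcongr; linarith
      _ = s / γ * (3 / 4 * R ^ 2) * M ^ 2 := by rw [hs]; ring
      _ ≤ s / γ * (3 / 4 * R ^ 2) * (2 * (A ^ 2 + B ^ 2)) := by gcongr
      _ = s / γ * (3 / 2 * R ^ 2) * (A ^ 2 + B ^ 2) := by ring
      _ ≤ s / γ * (5 / 4 * R) ^ 2 * (A ^ 2 + B ^ 2) := by gcongr; nlinarith [sq_nonneg R]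
      _ ≤ _ := by gcongr
  have h4 : N * (4 * (2 * t ^ 2 * LH * (11 / 4 * M)) ^ 2) ≤
      132 * (LH * s) ^ 2 * (A ^ 2 + B ^ 2) := by
    have h5 : N * t ^ 4 ≤ s ^ 2 / 64 := by
      have : N * t ^ 4 = s * t * t ^ 2 := by rw [hs]; ring
      have hts : t ≤ s := by rw [hs]; nlinarith
      have : t ^ 2 ≤ 1 / 64 := by nlinarith
      calc N * t ^ 4 = s * t * t ^ 2 := by rw [hs]; ring
        _ ≤ s * s * (1 / 64) := by gcongr
        _ = s ^ 2 / 64 := by ring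
    calc N * (4 * (2 * t ^ 2 * LH * (11 / 4 * M)) ^ 2)
        = 121 * LH ^ 2 * (N * t ^ 4) * M ^ 2 := by ring
      _ ≤ 121 * LH ^ 2 * (s ^ 2 / 64) * (2 * (A ^ 2 + B ^ 2)) := by gcongr
      _ = 121 / 32 * ((LH * s) ^ 2 * (A ^ 2 + B ^ 2)) := by ring
      _ ≤ 132 * ((LH * s) ^ 2 * (A ^ 2 + B ^ 2)) := by gcongr; norm_num
      _ = _ := by ring
  linarith

end Bound

/-- The Hamiltonian flow of a potential with bounded and Lipschitz Hessian. -/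
lemma isNewtonFlow_gradient {d : ℕ} (hd : 1 ≤ d) {U : Ed d → ℝ} (hU : ContDiff ℝ 2 U)
    (hHess : ∀ x, ‖fderiv ℝ (gradient U) x‖ ≤ 1) {LH : ℝ}
    (hHessLip : ∀ x x' : Ed d,
      frobNorm (fderiv ℝ (gradient U) x - fderiv ℝ (gradient U) x') ≤ LH * ‖x - x'‖)
    {Φ : ℝ → Phase d → Phase d} (hΦ0 : ∀ z, Φ 0 z = z)
    (hΦ : ∀ z s, HasDerivAt (fun u => Φ u z) ((Φ s z).2, -gradient U (Φ s z).1) s) :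
    IsNewtonFlow (gradient U) LH Φ where
  differentiable := by
    have h1 : Differentiable ℝ (fderiv ℝ U) :=
      (hU.fderiv_right (m := 1) (by norm_num)).differentiable (by norm_num)
    exact (InnerProductSpace.toDual ℝ (Ed d)).symm.differentiable.comp h1
  norm_fderiv_le := hHess
  frobNorm_sub_le := hHessLip
  nonneg := by
    have h := (Real.sqrt_nonneg _).trans (hHessLip (EuclideanSpace.single ⟨0, hd⟩ 1) 0)
    simpa using h
  zero := hΦ0
  hasDerivAt := hΦ

/-- Proposition 4.3, second part: `n`-step entropy bound between the laws of the chain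
`Q = D_η H_t D_η` started from two Dirac masses. -/
theorem hmc_n_step_entropy_bound
    {d : ℕ} (hd : 1 ≤ d) (U : Ed d → ℝ) (hU : ContDiff ℝ 2 U)
    (hHess : ∀ x, ‖fderiv ℝ (gradient U) x‖ ≤ 1)
    (LH : ℝ)
    (hHessLip : ∀ x x' : Ed d,
      frobNorm (fderiv ℝ (gradient U) x - fderiv ℝ (gradient U) x') ≤ LH * ‖x - x'‖)
    (t : ℝ) (ht0 : 0 < t) (ht : t ≤ 1 / 8)
    (η : ℝ) (hη0 : 0 < η) (hη1 : η < 1)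
    (γ : ℝ) (hγ : γ = (1 - η) / t)
    (Φ : ℝ → Phase d → Phase d)
    (hΦ0 : ∀ z, Φ 0 z = z)
    (hΦ : ∀ z s, HasDerivAt (fun u => Φ u z) ((Φ s z).2, -gradient U (Φ s z).1) s) :
    ∀ n : ℕ, 2 ≤ n → ∀ x v x' v' : Ed d,
      ∀ s : ℝ, s = t * (min n ⌊1 / (4 * t)⌋₊ : ℕ) →
        relEnt ((stepQ Φ t η)^[n] (Measure.dirac (x, v)))
            ((stepQ Φ t η)^[n] (Measure.dirac (x', v'))) ≤
          (s / γ * (12 / (η * s ^ 2) + 6 * γ / (η * s) + 4) ^ 2 + 132 * (LH * s) ^ 2) *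
            (‖x - x'‖ ^ 2 + (η * (min n ⌊1 / (4 * t)⌋₊ : ℕ) * t) ^ 2 * ‖v - v'‖ ^ 2) := by
  intro n hn x v x' v' s hs
  have h := isNewtonFlow_gradient hd hU hHess hHessLip hΦ0 hΦ
  have hfloor : 2 ≤ ⌊1 / (4 * t)⌋₊ := by
    apply Nat.le_floor
    rw [le_div_iff₀ (by positivity)]
    push_cast
    linarith
  obtain ⟨N, hN⟩ : ∃ N, N = min n ⌊1 / (4 * t)⌋₊ := ⟨_, rfl⟩
  rw [← hN] at hs ⊢
  have hN2 : 2 ≤ N := hN ▸ le_min hn hfloor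
  have hNn : N ≤ n := hN ▸ min_le_left _ _
  have hN2' : (2 : ℝ) ≤ N := by exact_mod_cast hN2
  have hs0 : 0 < s := by rw [hs]; positivity
  have hs4 : s ≤ 1 / 4 := by
    have h1 : (N : ℝ) ≤ 1 / (4 * t) :=
      (Nat.cast_le.2 (hN ▸ min_le_right _ _)).trans (Nat.floor_le (by positivity))
    rw [le_div_iff₀ (by positivity)] at h1
    rw [hs]
    linarith
  have hγ0 : 0 < γ := by rw [hγ]; exact div_pos (by linarith) ht0
  have hγt : γ * t = 1 - η := by rw [hγ]; field_simp
  have hσ2 : 0 < 1 - η ^ 2 := by nlinarith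
  obtain ⟨M, hM⟩ : ∃ M, M = ‖x' - x‖ + t * N * ‖η • (v' - v)‖ := ⟨_, rfl⟩
  have hM0 : 0 ≤ M := by rw [hM]; positivity
  obtain ⟨w, δ, hδ0, hδN, hwN, hδ, hw, hw0, hwd, hδM⟩ :=
    exists_steering_path (x' - x) (η • (v' - v)) (by omega : 1 ≤ N) ht0 hM
  rw [← hs] at hw0 hwd
  simp only [← hs] at hw
  have hts : t / s ≤ 1 / 2 := by
    rw [div_le_iff₀ hs0, hs]; nlinarith
  have hρ : 6 * M * t / s ^ 2 + (1 - η ^ 2) * (7 / 4 * M / s) + 2 * t * (11 / 4 * M) ≤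
      t * (M * (6 / s ^ 2 + 7 / 2 * γ / s + 11 / 2)) := by
    have h1 : (1 - η ^ 2) * (7 / 4 * M / s) ≤ (2 * (γ * t)) * (7 / 4 * M / s) := by
      gcongr
      rw [hγt]
      nlinarith
    calc _ ≤ 6 * M * t / s ^ 2 + (2 * (γ * t)) * (7 / 4 * M / s) + 2 * t * (11 / 4 * M) := by
          gcongr
      _ = _ := by ring
  have hmain := h.entropyDualLE_of_path ht0 ht hη0.le hη1 hδN hwN hδ
    (m := 11 / 4 * M) (fun k hk => by
      have h1 : t * ‖w k‖ ≤ 1 / 2 * (7 / 4 * M) := by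
        calc t * ‖w k‖ ≤ t * (7 / 4 * M / s) := by gcongr; exact hw k hk.le
          _ = t / s * (7 / 4 * M) := by ring
          _ ≤ _ := by gcongr
      linarith [hδM k hk.le]) (fun k hk => hw k hk.le) hwd hρ (n - N) (N - 1) 0 (by omega) x v x' v'
    hδ0.symm (by
      refine hw0.trans (le_trans ?_ hρ)
      have : 0 ≤ (1 - η ^ 2) * (7 / 4 * M / s) := by positivity
      have : 0 ≤ 2 * t * (11 / 4 * M) := by positivity
      linarith)
  have hn' : N - 1 + 1 + (n - N) = n := by omega
  have hNc : ((N - 1 : ℕ) : ℝ) + 1 = N := by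
    rw [Nat.cast_sub (by omega)]; push_cast; ring
  rw [hn', hNc] at hmain
  have hcost := steering_cost_le (LH := LH) (A := ‖x' - x‖) (B := t * N * ‖η • (v' - v)‖) hN2' ht0
    ht hs hs4 hγ0 hη0 hη1.le (Real.sqrt_pos.2 hσ2)
    (by rw [Real.sq_sqrt hσ2.le, hγt]; nlinarith) (norm_nonneg _) (by positivity) hM
  have hB : (t * N * ‖η • (v' - v)‖) ^ 2 = (η * N * t) ^ 2 * ‖v - v'‖ ^ 2 := by
    rw [norm_smul, Real.norm_of_nonneg hη0.le, norm_sub_rev v' v]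
    ring
  rw [hB, norm_sub_rev x' x] at hcost
  have hΦc := (h.lipschitzWith ht0.le ht).continuous
  rw [stepQ_iterate_dirac hΦc, stepQ_iterate_dirac hΦc]
  exact relEnt_le_of_entropyDualLE (by positivity) (hmain.mono hcost)
end

section
/- Let η ∈ (0,1) and let h be a C¹, Lipschitz, bounded and positively lower-bounded probability density with respect to μ = π ⊗ N(0,I_d). Then ∫ D_η h · ln(D_η h) dμ − ∫ h ln h dμ ≤ −((η⁻² − 1)/2) ∫ |∇_v D_η h|²/(D_η h) dμ. -/
open MeasureTheory Real Set

/-- Normalising a finite measure with density `exp V` gives a probability measure. -/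
theorem isProbabilityMeasure_normalized_withDensity_exp {d : ℕ} {V : Ed d → ℝ}
    (hinteg : Integrable fun x => Real.exp (V x)) :
    IsProbabilityMeasure
      (((volume.withDensity fun x => ENNReal.ofReal (Real.exp (V x))) Set.univ)⁻¹ •
        volume.withDensity fun x => ENNReal.ofReal (Real.exp (V x))) := by
  have hmass : (volume.withDensity fun x => ENNReal.ofReal (Real.exp (V x))) Set.univ
      = ENNReal.ofReal (∫ x, Real.exp (V x)) := by
    rw [withDensity_apply _ MeasurableSet.univ, Measure.restrict_univ,
      ofReal_integral_eq_lintegral_ofReal hinteg (ae_of_all _ fun x => (Real.exp_pos _).le)]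
  have hpos : 0 < ∫ x, Real.exp (V x) := integral_exp_pos hinteg
  constructor
  rw [Measure.smul_apply, smul_eq_mul, hmass]
  exact ENNReal.inv_mul_cancel (by simpa using hpos) ENNReal.ofReal_ne_top

theorem integrable_exp_neg_half_norm_sq (d : ℕ) :
    Integrable fun v : Ed d => Real.exp (-‖v‖ ^ 2 / 2) := by
  have := (GaussianFourier.integrable_cexp_neg_mul_sq_norm_add (V := Ed d) (b := (1 / 2 : ℂ))
    (by norm_num) 0 0).norm
  refine this.congr (ae_of_all _ fun v => ?_)
  simp only [Complex.norm_exp]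
  congr 1
  simp [← Complex.ofReal_pow]
  ring

instance isProbabilityMeasure_stdGaussian (d : ℕ) : IsProbabilityMeasure (stdGaussian d) :=
  isProbabilityMeasure_normalized_withDensity_exp (integrable_exp_neg_half_norm_sq d)

theorem exists_stdGaussian_eq_smul (d : ℕ) : ∃ c : ENNReal, c ≠ 0 ∧ c ≠ ⊤ ∧
    stdGaussian d =
      c • volume.withDensity fun v : Ed d => ENNReal.ofReal (Real.exp (-‖v‖ ^ 2 / 2)) := by
  refine ⟨_, ?_, ?_, rfl⟩
  · rw [withDensity_apply _ MeasurableSet.univ, Measure.restrict_univ]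
    exact ENNReal.inv_ne_zero.2 (integrable_exp_neg_half_norm_sq d).lintegral_lt_top.ne
  · intro htop
    have h1 := (isProbabilityMeasure_stdGaussian d).measure_univ
    rw [stdGaussian, htop, Measure.smul_apply, smul_eq_mul] at h1
    rw [ENNReal.inv_eq_top] at htop
    simp [htop] at h1

theorem integral_stdGaussian_s17 (d : ℕ) : ∃ c : ℝ, ∀ {F : Type} [NormedAddCommGroup F]
    [NormedSpace ℝ F] (f : Ed d → F),
      ∫ v, f v ∂stdGaussian d = c • ∫ v, Real.exp (-‖v‖ ^ 2 / 2) • f v := by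
  obtain ⟨c, -, -, hc⟩ := exists_stdGaussian_eq_smul d
  refine ⟨c.toReal, fun f => ?_⟩
  rw [hc, integral_smul_measure, integral_withDensity_eq_integral_toReal_smul (by fun_prop)
    (ae_of_all _ fun _ => ENNReal.ofReal_lt_top)]
  simp_rw [ENNReal.toReal_ofReal (Real.exp_pos _).le]

theorem integrable_exp_smul_of_integrable_stdGaussian {d : ℕ} {f : Ed d → ℝ}
    (hf : Integrable f (stdGaussian d)) :
    Integrable fun v => Real.exp (-‖v‖ ^ 2 / 2) * f v := by
  obtain ⟨c, hc0, hct, hc⟩ := exists_stdGaussian_eq_smul d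
  rw [hc, integrable_smul_measure hc0 hct, integrable_withDensity_iff_integrable_smul'
    (by fun_prop) (ae_of_all _ fun _ => ENNReal.ofReal_lt_top)] at hf
  simpa only [ENNReal.toReal_ofReal (Real.exp_pos _).le, smul_eq_mul] using hf

theorem integral_cexp_inner_stdGaussian {d : ℕ} (c : ℂ) (w : Ed d) :
    ∫ v, Complex.exp (c * (inner ℝ w v : ℝ)) ∂stdGaussian d =
      Complex.exp (c ^ 2 * ‖w‖ ^ 2 / 2) := by
  obtain ⟨C, hC⟩ := integral_stdGaussian_s17 d
  have key (c : ℂ) (w : Ed d) : ∫ v, Complex.exp (c * (inner ℝ w v : ℝ)) ∂stdGaussian d =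
      (C * ((π : ℂ) / (1 / 2)) ^ ((Module.finrank ℝ (Ed d) : ℂ) / 2)) *
        Complex.exp (c ^ 2 * ‖w‖ ^ 2 / 2) := by
    rw [hC, mul_assoc]
    have := GaussianFourier.integral_cexp_neg_mul_sq_norm_add (V := Ed d) (b := (1 / 2 : ℂ))
      (by norm_num) c w
    rw [show (4 : ℂ) * (1 / 2) = 2 by norm_num] at this
    rw [← this, Complex.real_smul]
    congr 2
    ext v
    rw [Complex.real_smul, Complex.ofReal_exp, ← Complex.exp_add]
    congr 1
    push_cast
    ring
  have h0 := key 0 0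
  simp only [zero_mul, Complex.exp_zero, integral_const, probReal_univ, one_smul, ne_eq,
    OfNat.ofNat_ne_zero, not_false_eq_true, zero_pow, zero_div, mul_one] at h0
  rw [key, ← h0, one_mul]

theorem integral_exp_inner_stdGaussian {d : ℕ} (w : Ed d) :
    ∫ v, Real.exp (inner ℝ w v) ∂stdGaussian d = Real.exp (‖w‖ ^ 2 / 2) := by
  have := integral_cexp_inner_stdGaussian 1 w
  simp only [one_mul, one_pow] at this
  exact_mod_cast this

theorem integrable_exp_inner_stdGaussian {d : ℕ} (w : Ed d) :
    Integrable (fun v => Real.exp (inner ℝ w v)) (stdGaussian d) :=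
  .of_integral_ne_zero (by rw [integral_exp_inner_stdGaussian]; positivity)

theorem integrable_inner_stdGaussian {d : ℕ} (w : Ed d) :
    Integrable (fun v => inner ℝ w v) (stdGaussian d) := by
  refine ((integrable_exp_inner_stdGaussian w).add (integrable_exp_inner_stdGaussian (-w))).mono'
    (by fun_prop) (ae_of_all _ fun v => ?_)
  simp only [Pi.add_apply, inner_neg_left, Real.norm_eq_abs]
  set x : ℝ := inner ℝ w v
  have h1 := Real.add_one_le_exp x
  have h2 := Real.add_one_le_exp (-x)
  have h3 := Real.exp_pos x
  have h4 := Real.exp_pos (-x)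
  exact abs_le.2 ⟨by linarith, by linarith⟩

theorem charFun_stdGaussian {d : ℕ} (t : Ed d) :
    charFun (stdGaussian d) t = Complex.exp (-(‖t‖ ^ 2 / 2)) := by
  rw [charFun_apply]
  refine (integral_congr_ae (ae_of_all _ fun v => ?_)).trans
    ((integral_cexp_inner_stdGaussian Complex.I t).trans ?_)
  · rw [real_inner_comm, mul_comm]
  · rw [Complex.I_sq]
    ring_nf

/-- The standard Gaussian measure is invariant under the velocity refreshment. -/
theorem integral_integral_refresh_stdGaussian {d : ℕ} {a b : ℝ} (hab : a ^ 2 + b ^ 2 = 1)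
    {f : Ed d → ℝ} (hf : Continuous f) {M : ℝ} (hM : ∀ v, |f v| ≤ M) :
    ∫ v, ∫ g, f (a • v + b • g) ∂stdGaussian d ∂stdGaussian d = ∫ v, f v ∂stdGaussian d := by
  have hprob (r : ℝ) : IsProbabilityMeasure ((stdGaussian d).map (r • ·)) :=
    Measure.isProbabilityMeasure_map (by fun_prop)
  have hconv : ((stdGaussian d).map (a • ·)) ∗ ((stdGaussian d).map (b • ·)) =
      stdGaussian d := by
    refine Measure.ext_of_charFun (funext fun t => ?_)
    rw [charFun_conv, charFun_map_smul, charFun_map_smul, charFun_stdGaussian,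
      charFun_stdGaussian, charFun_stdGaussian, ← Complex.exp_add, norm_smul, norm_smul]
    congr 1
    have h1 : (‖a‖ * ‖t‖) ^ 2 + (‖b‖ * ‖t‖) ^ 2 = ‖t‖ ^ 2 := by
      simp only [mul_pow, Real.norm_eq_abs, sq_abs]
      linear_combination ‖t‖ ^ 2 * hab
    have h2 := congrArg (fun x : ℝ => (x : ℂ)) h1
    push_cast at h2 ⊢
    linear_combination -h2 / 2
  have hfi : Integrable f (((stdGaussian d).map (a • ·)) ∗ ((stdGaussian d).map (b • ·))) :=
    (integrable_const M).mono' hf.aestronglyMeasurable (ae_of_all _ hM)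
  have h1 := integral_conv hfi
  rw [hconv] at h1
  rw [h1, integral_map (by fun_prop)]
  · congr 1
    ext v
    rw [integral_map (by fun_prop) (by fun_prop)]
  · exact (StronglyMeasurable.integral_prod_right (f := fun x y : Ed d => f (x + y))
      (Continuous.stronglyMeasurable (by fun_prop))).aestronglyMeasurable

/-- Gaussian integration by parts. -/
theorem integral_fderiv_stdGaussian {d : ℕ} {F : Ed d → ℝ} (hF : ContDiff ℝ 1 F)
    {M L : ℝ} (hM : ∀ v, |F v| ≤ M) (hL : ∀ v, ‖fderiv ℝ F v‖ ≤ L) (u : Ed d) :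
    ∫ v, fderiv ℝ F v u ∂stdGaussian d = ∫ v, F v * inner ℝ u v ∂stdGaussian d := by
  obtain ⟨C, hC⟩ := integral_stdGaussian_s17 d
  have hcont : Continuous fun v => fderiv ℝ F v u := (hF.continuous_fderiv (by simp)).clm_apply
    continuous_const
  have hFc := hF.continuous
  have hexp (v : Ed d) : HasFDerivAt (fun v : Ed d => Real.exp (-‖v‖ ^ 2 / 2))
      (Real.exp (-‖v‖ ^ 2 / 2) • (-(innerSL ℝ v))) v := by
    have h1 := ((hasStrictFDerivAt_norm_sq v).hasFDerivAt.neg.mul_const (1 / 2 : ℝ)).exp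
    have hfun : (fun v : Ed d => Real.exp (-‖v‖ ^ 2 / 2)) =
        fun v => Real.exp (-‖v‖ ^ 2 * (1 / 2)) := by
      ext v
      rw [div_eq_mul_one_div]
    rw [hfun]
    refine h1.congr_fderiv ?_
    ext u
    simp
    left
    ring_nf
  have h1 : Integrable (fun v => fderiv ℝ F v u) (stdGaussian d) :=
    (integrable_const (L * ‖u‖)).mono' hcont.aestronglyMeasurable (ae_of_all _ fun v =>
      ((fderiv ℝ F v).le_opNorm u).trans (by gcongr; exact hL v))
  have h2 : Integrable (fun v => F v * inner ℝ u v) (stdGaussian d) :=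
    (integrable_inner_stdGaussian u).bdd_mul hFc.aestronglyMeasurable (ae_of_all _ hM)
  have h3 : Integrable F (stdGaussian d) :=
    (integrable_const M).mono' hFc.aestronglyMeasurable (ae_of_all _ hM)
  have hderiv (v : Ed d) : F v * fderiv ℝ (fun v : Ed d => Real.exp (-‖v‖ ^ 2 / 2)) v u =
      -(Real.exp (-‖v‖ ^ 2 / 2) * (F v * inner ℝ u v)) := by
    rw [(hexp v).fderiv]
    simp [real_inner_comm]
    ring
  have ibp := integral_mul_fderiv_eq_neg_fderiv_mul_of_integrable (μ := (volume : Measure (Ed d)))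
    (f := F) (g := fun v : Ed d => Real.exp (-‖v‖ ^ 2 / 2)) (v := u)
    (by simpa only [mul_comm] using integrable_exp_smul_of_integrable_stdGaussian h1)
    (by simp only [hderiv]; exact (integrable_exp_smul_of_integrable_stdGaussian h2).neg)
    (by simpa only [mul_comm] using integrable_exp_smul_of_integrable_stdGaussian h3)
    (fun v _ => (hF.differentiable (by simp)) v) (fun v _ => (hexp v).differentiableAt)
  simp only [hderiv, integral_neg, neg_inj] at ibp
  rw [hC, hC]
  simp only [smul_eq_mul]
  rw [ibp]
  simp only [mul_comm]

/-- Gibbs variational inequality for the standard Gaussian measure, tested against exponentials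
of linear functions. -/
theorem mul_log_add_integral_inner_le_integral_mul_log {d : ℕ} {F : Ed d → ℝ}
    (hF : Continuous F) {c M : ℝ} (hc : 0 < c) (hcF : ∀ v, c ≤ F v) (hM : ∀ v, |F v| ≤ M)
    (a : Ed d) :
    (∫ v, F v ∂stdGaussian d) * Real.log (∫ v, F v ∂stdGaussian d) +
        ∫ v, F v * inner ℝ a v ∂stdGaussian d -
        ‖a‖ ^ 2 / 2 * ∫ v, F v ∂stdGaussian d ≤
      ∫ v, F v * Real.log (F v) ∂stdGaussian d := by
  have hFi : Integrable F (stdGaussian d) :=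
    (integrable_const M).mono' hF.aestronglyMeasurable (ae_of_all _ hM)
  have hFa : Integrable (fun v => F v * inner ℝ a v) (stdGaussian d) :=
    (integrable_inner_stdGaussian a).bdd_mul hF.aestronglyMeasurable (ae_of_all _ hM)
  have hpos (v : Ed d) : 0 < F v := hc.trans_le (hcF v)
  have hlog : Continuous fun v => Real.log (F v) := hF.log fun v => (hpos v).ne'
  have hFl : Integrable (fun v => F v * Real.log (F v)) (stdGaussian d) := by
    refine (integrable_const (M * max |Real.log c| |Real.log M|)).mono'
      (hF.mul hlog).aestronglyMeasurable (ae_of_all _ fun v => ?_)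
    have hFM := (le_abs_self _).trans (hM v)
    rw [norm_mul, Real.norm_eq_abs, Real.norm_eq_abs]
    exact mul_le_mul (hM v) (abs_le_max_abs_abs (Real.log_le_log hc (hcF v))
      (Real.log_le_log (hpos v) hFM)) (abs_nonneg _) ((abs_nonneg _).trans (hM v))
  set m := ∫ v, F v ∂stdGaussian d with hm
  have hm0 : 0 < m := by
    have := integral_mono (integrable_const c) hFi hcF
    simp only [integral_const, probReal_univ, one_smul] at this
    exact hc.trans_le this
  have hE := integrable_exp_inner_stdGaussian a
  have hpt (v : Ed d) : F v * (Real.log m - ‖a‖ ^ 2 / 2) + F v * inner ℝ a v +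
      (F v - m * Real.exp (-(‖a‖ ^ 2 / 2)) * Real.exp (inner ℝ a v)) ≤
        F v * Real.log (F v) := by
    have h1 := Real.add_one_le_exp
      (Real.log m - ‖a‖ ^ 2 / 2 + inner ℝ a v - Real.log (F v))
    have h2 : Real.exp (Real.log m - ‖a‖ ^ 2 / 2 + inner ℝ a v - Real.log (F v)) * F v =
        m * Real.exp (-(‖a‖ ^ 2 / 2)) * Real.exp (inner ℝ a v) := by
      rw [Real.exp_sub, Real.exp_log (hpos v), div_mul_cancel₀ _ (hpos v).ne', Real.exp_add,
        sub_eq_add_neg, Real.exp_add, Real.exp_log hm0]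
    have h3 := mul_le_mul_of_nonneg_right h1 (hpos v).le
    rw [h2] at h3
    linarith
  have hinteg := integral_mono (((hFi.mul_const _).add hFa).add (hFi.sub (hE.const_mul _))) hFl hpt
  refine le_trans (le_of_eq ?_) hinteg
  rw [integral_add' ((hFi.mul_const _).add hFa) (hFi.sub (hE.const_mul _)),
    integral_add' (hFi.mul_const _) hFa, integral_sub' hFi (hE.const_mul _), integral_mul_const,
    integral_const_mul, integral_exp_inner_stdGaussian, ← hm, mul_assoc m, ← Real.exp_add]
  simp
  ring

/-- The gradient of the refreshed function, computed by differentiating under the integral and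
integrating by parts. -/
theorem inner_gradient_refresh {d : ℕ} {k : Ed d → ℝ} (hk : ContDiff ℝ 1 k) {M : ℝ}
    (hM : ∀ v, |k v| ≤ M) {L : NNReal} (hL : LipschitzWith L k) (a b : ℝ) (v u : Ed d) :
    b * inner ℝ (gradient (fun v => ∫ g, k (a • v + b • g) ∂stdGaussian d) v) u =
      a * ∫ g, k (a • v + b • g) * inner ℝ u g ∂stdGaussian d := by
  have hkc := hk.continuous
  have hk'c := hk.continuous_fderiv (by simp)
  have hkd := hk.differentiable (by simp)
  have hL' (w : Ed d) : ‖fderiv ℝ k w‖ ≤ L := norm_fderiv_le_of_lipschitz ℝ hL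
  have hk'i : Integrable (fun g => fderiv ℝ k (a • v + b • g)) (stdGaussian d) :=
    (integrable_const (L : ℝ)).mono' (by fun_prop) (ae_of_all _ fun g => hL' _)
  have hd := hasFDerivAt_integral_of_dominated_of_fderiv_le (𝕜 := ℝ) (μ := stdGaussian d)
    (F := fun v g => k (a • v + b • g)) (F' := fun v g => a • fderiv ℝ k (a • v + b • g))
    (x₀ := v) (s := Set.univ) (bound := fun _ => |a| * L) Filter.univ_mem
    (Filter.Eventually.of_forall fun w => by fun_prop)
    ((integrable_const M).mono' (by fun_prop) (ae_of_all _ fun g => hM _))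
    (hk'i.smul a).aestronglyMeasurable
    (ae_of_all _ fun g w _ => by
      rw [norm_smul, Real.norm_eq_abs]
      gcongr
      exact hL' _)
    (integrable_const _)
    (ae_of_all _ fun g w _ => by
      have h1 := (hkd (a • w + b • g)).hasFDerivAt.comp w
        (((hasFDerivAt_id w).const_smul a).add_const (b • g))
      refine h1.congr_fderiv ?_
      ext u
      simp)
  have hFd (g : Ed d) : HasFDerivAt (fun g => k (a • v + b • g))
      (b • fderiv ℝ k (a • v + b • g)) g := by
    have h1 := (hkd (a • v + b • g)).hasFDerivAt.comp g
      (((hasFDerivAt_id g).const_smul b).const_add (a • v))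
    refine h1.congr_fderiv ?_
    ext u
    simp
  have ibp := integral_fderiv_stdGaussian (F := fun g => k (a • v + b • g)) (by fun_prop)
    (M := M) (L := |b| * L) (fun g => hM _)
    (fun g => by
      rw [(hFd g).fderiv, norm_smul, Real.norm_eq_abs]
      gcongr
      exact hL' _) u
  simp only [(hFd _).fderiv, _root_.smul_apply, smul_eq_mul,
    integral_const_mul] at ibp
  rw [inner_gradient_left, hd.fderiv, ← ibp, integral_smul, _root_.smul_apply,
    ContinuousLinearMap.integral_apply hk'i, smul_eq_mul]
  ring

/-- Reverse local logarithmic Sobolev inequality for the Ornstein–Uhlenbeck semigroup. -/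
theorem reverse_local_logSobolev {d : ℕ} {k : Ed d → ℝ} (hk : ContDiff ℝ 1 k) {c M : ℝ}
    (hc : 0 < c) (hck : ∀ v, c ≤ k v) (hM : ∀ v, |k v| ≤ M) {L : NNReal}
    (hL : LipschitzWith L k) {a b : ℝ} (ha : a ≠ 0) (hb : b ≠ 0) (v : Ed d) :
    b ^ 2 / (2 * a ^ 2) * (‖gradient (fun v => ∫ g, k (a • v + b • g) ∂stdGaussian d) v‖ ^ 2 /
        ∫ g, k (a • v + b • g) ∂stdGaussian d) ≤
      (∫ g, k (a • v + b • g) * Real.log (k (a • v + b • g)) ∂stdGaussian d) -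
        (∫ g, k (a • v + b • g) ∂stdGaussian d) *
          Real.log (∫ g, k (a • v + b • g) ∂stdGaussian d) := by
  have hkc := hk.continuous
  have hgrad := inner_gradient_refresh hk hM hL a b v
  set p := gradient (fun v => ∫ g, k (a • v + b • g) ∂stdGaussian d) v
  have hvar := mul_log_add_integral_inner_le_integral_mul_log
    (F := fun g => k (a • v + b • g)) (by fun_prop) hc (fun g => hck _) (fun g => hM _)
  set m := ∫ g, k (a • v + b • g) ∂stdGaussian d with hm
  have hm0 : 0 < m := by
    have := integral_mono (integrable_const c) ((integrable_const M).mono'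
      (f := fun g => k (a • v + b • g)) (by fun_prop) (ae_of_all (stdGaussian d) fun g => hM _))
      (fun g => hck (a • v + b • g))
    simp only [integral_const, probReal_univ, one_smul] at this
    exact hc.trans_le this
  specialize hvar ((b / (a * m)) • p)
  have h1 : ∫ g, k (a • v + b • g) * inner ℝ ((b / (a * m)) • p) g ∂stdGaussian d =
      b ^ 2 / (a ^ 2 * m) * ‖p‖ ^ 2 := by
    have h2 := hgrad ((b / (a * m)) • p)
    rw [inner_smul_right, real_inner_self_eq_norm_sq] at h2
    apply mul_left_cancel₀ ha
    rw [← h2]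
    field_simp
  rw [h1, norm_smul, mul_pow, Real.norm_eq_abs, sq_abs] at hvar
  have h3 : b ^ 2 / (2 * a ^ 2) * (‖p‖ ^ 2 / m) = b ^ 2 / (a ^ 2 * m) * ‖p‖ ^ 2 -
      (b / (a * m)) ^ 2 * ‖p‖ ^ 2 / 2 * m := by
    field_simp
    ring
  rw [h3]
  linarith

theorem integral_refreshFun_eqMeasure {d : ℕ} {U : Ed d → ℝ}
    [IsProbabilityMeasure (gibbs U)] {η : ℝ} (hη0 : 0 < η) (hη1 : η < 1) {f : Phase d → ℝ}
    (hf : Continuous f) {M : ℝ} (hM : ∀ z, |f z| ≤ M) :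
    Integrable (refreshFun η f) (eqMeasure U) ∧
      ∫ z, refreshFun η f z ∂eqMeasure U = ∫ z, f z ∂eqMeasure U := by
  have hprob : IsProbabilityMeasure (eqMeasure U) := by unfold eqMeasure; infer_instance
  have hinteg : Integrable (refreshFun η f) (eqMeasure U) := by
    refine (integrable_const M).mono' (StronglyMeasurable.integral_prod_right
      (f := fun (z : Phase d) (g : Ed d) => f (z.1, η • z.2 + Real.sqrt (1 - η ^ 2) • g))
      (Continuous.stronglyMeasurable (by fun_prop))).aestronglyMeasurable
      (ae_of_all _ fun z => ?_)
    have := norm_integral_le_of_norm_le_const (μ := stdGaussian d)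
      (f := fun g => f (z.1, η • z.2 + Real.sqrt (1 - η ^ 2) • g)) (ae_of_all _ fun g => hM _)
    rwa [probReal_univ, mul_one] at this
  have hfi : Integrable f (eqMeasure U) :=
    (integrable_const M).mono' hf.aestronglyMeasurable (ae_of_all _ hM)
  refine ⟨hinteg, ?_⟩
  unfold eqMeasure at hinteg hfi ⊢
  rw [integral_prod _ hinteg, integral_prod _ hfi]
  congr 1
  ext x
  have hs : η ^ 2 + Real.sqrt (1 - η ^ 2) ^ 2 = 1 := by
    rw [Real.sq_sqrt (by nlinarith)]
    ring
  exact integral_integral_refresh_stdGaussian hs (f := fun v => f (x, v))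
    (by fun_prop) fun v => hM _

/-- Entropy dissipation along the velocity-refreshment (Ornstein–Uhlenbeck) step `D_η`. -/
theorem refreshment_entropy_dissipation
    {d : ℕ} (hd : 1 ≤ d) (U : Ed d → ℝ) (hU : ContDiff ℝ 2 U)
    (hUint : Integrable fun x : Ed d => Real.exp (-U x))
    (η : ℝ) (hη0 : 0 < η) (hη1 : η < 1)
    (h : Phase d → ℝ) (hC1 : ContDiff ℝ 1 h)
    (hLip : ∃ Lc : NNReal, LipschitzWith Lc h)
    (hbdd : ∃ M, ∀ z, h z ≤ M)
    (hlow : ∃ c, 0 < c ∧ ∀ z, c ≤ h z)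
    (hdens : (∫ z, h z ∂eqMeasure U) = 1) :
    (∫ z, refreshFun η h z * Real.log (refreshFun η h z) ∂eqMeasure U) -
        ∫ z, h z * Real.log (h z) ∂eqMeasure U ≤
      -(((η⁻¹) ^ 2 - 1) / 2) *
        ∫ z, ‖gradV (refreshFun η h) z‖ ^ 2 / refreshFun η h z ∂eqMeasure U := by
  obtain ⟨L, hL⟩ := hLip
  obtain ⟨M, hM⟩ := hbdd
  obtain ⟨c, hc, hch⟩ := hlow
  have hgibbs : IsProbabilityMeasure (gibbs U) :=
    isProbabilityMeasure_normalized_withDensity_exp hUint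
  have hpos (z : Phase d) : 0 < h z := hc.trans_le (hch z)
  have hMabs (z : Phase d) : |h z| ≤ M := by rw [abs_of_pos (hpos z)]; exact hM z
  have hhc := hC1.continuous
  have hb : 0 < Real.sqrt (1 - η ^ 2) := Real.sqrt_pos.2 (by nlinarith)
  have hb2 : Real.sqrt (1 - η ^ 2) ^ 2 = 1 - η ^ 2 := Real.sq_sqrt (by nlinarith)
  have hlogM {x : ℝ} (hx : c ≤ x) (hx' : x ≤ M) :
      |x * Real.log x| ≤ M * max |Real.log c| |Real.log M| := by
    have hx0 : 0 < x := hc.trans_le hx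
    rw [abs_mul, abs_of_pos hx0]
    exact mul_le_mul hx' (abs_le_max_abs_abs (Real.log_le_log hc hx)
      (Real.log_le_log hx0 hx')) (abs_nonneg _) (hx0.le.trans hx')
  obtain ⟨hDi, -⟩ := integral_refreshFun_eqMeasure (U := U) hη0 hη1 hhc hMabs
  obtain ⟨hPi, hPeq⟩ := integral_refreshFun_eqMeasure (U := U) hη0 hη1
    (f := fun z => h z * Real.log (h z)) (hhc.mul (hhc.log fun z => (hpos z).ne'))
    (fun z => hlogM (hch z) (hM z))
  have hDbd (z : Phase d) : c ≤ refreshFun η h z ∧ refreshFun η h z ≤ M := by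
    have hi : Integrable (fun g => h (z.1, η • z.2 + Real.sqrt (1 - η ^ 2) • g))
        (stdGaussian d) :=
      (integrable_const M).mono' (by fun_prop) (ae_of_all _ fun g => hMabs _)
    have h1 := integral_mono (integrable_const c) hi fun g => hch _
    have h2 := integral_mono hi (integrable_const M) fun g => hM _
    simp only [integral_const, probReal_univ, one_smul] at h1 h2
    exact ⟨h1, h2⟩
  have hprob : IsProbabilityMeasure (eqMeasure U) := by unfold eqMeasure; infer_instance
  have hDl : Integrable (fun z => refreshFun η h z * Real.log (refreshFun η h z))
      (eqMeasure U) :=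
    (integrable_const _).mono' (hDi.aemeasurable.mul hDi.aemeasurable.log).aestronglyMeasurable
      (ae_of_all _ fun z => hlogM (hDbd z).1 (hDbd z).2)
  have hpt (z : Phase d) : ((η⁻¹) ^ 2 - 1) / 2 *
      (‖gradV (refreshFun η h) z‖ ^ 2 / refreshFun η h z) ≤
        refreshFun η (fun z => h z * Real.log (h z)) z -
          refreshFun η h z * Real.log (refreshFun η h z) := by
    have hcoef : ((η⁻¹) ^ 2 - 1) / 2 = Real.sqrt (1 - η ^ 2) ^ 2 / (2 * η ^ 2) := by
      rw [hb2]
      field_simp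
    rw [hcoef]
    have hLv : LipschitzWith L fun v => h (z.1, v) := by
      simpa [Function.comp_def] using hL.comp (LipschitzWith.prodMk_left z.1)
    exact reverse_local_logSobolev (k := fun v => h (z.1, v)) (by fun_prop) hc
      (fun v => hch _) (fun v => hMabs _) hLv hη0.ne' hb.ne' z.2
  have hcoef0 : 0 ≤ ((η⁻¹) ^ 2 - 1) / 2 := by
    have := one_le_pow₀ (n := 2) ((one_le_inv₀ hη0).2 hη1.le)
    linarith
  have hmain := integral_mono_of_nonneg (μ := eqMeasure U)
    (ae_of_all _ fun z => mul_nonneg hcoef0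
      (div_nonneg (sq_nonneg _) (hc.le.trans (hDbd z).1)))
    (hPi.sub hDl) (ae_of_all _ hpt)
  rw [integral_const_mul] at hmain
  simp only [Pi.sub_apply] at hmain
  rw [integral_sub hPi hDl, hPeq] at hmain
  linarith
end
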